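/- arXiv:2108.02518 — 2 statements merged into one kernel-verified Lean document; each statement's English description precedes it below -/
import Mathlib

section
/- Let v be a simplicial vertex of a vertex-weighted digraph (G,ψ) on [ℓ], and let e be the number of edges of G incident to or from v. Then χ_{A(G,ψ)}(t) = (t − (|ψ(v)| + e + ℓ − 1))·χ_{A(G∖v, ψ|_{[ℓ]∖{v}})}(t), where G∖v is the induced subdigraph of G on [ℓ]∖{v} and ψ|_{[ℓ]∖{v}} is the restricted weight map. -/
open scoped Classical
open Finset

noncomputable section

namespace Paper

variable {ι : Type}

/-- The intersection of a finite collection of subsets of `ι → ℝ`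
(the empty intersection being the whole space). -/
def inter (B : Finset (Set (ι → ℝ))) : Set (ι → ℝ) := ⋂ H ∈ B, H

/-- The intersection poset `L(A)` of an arrangement `A`: all nonempty intersections
of subcollections of `A` (including the whole space as the empty intersection),
ordered by reverse inclusion. -/
def L (A : Finset (Set (ι → ℝ))) : Finset (Set (ι → ℝ)) :=
  (A.powerset.image inter).filter fun X => X.Nonempty

/-- The dimension of a subset of `ι → ℝ` (as the dimension of the direction of
its affine span). -/
def dim (X : Set (ι → ℝ)) : ℕ := Module.finrank ℝ (affineSpan ℝ X).direction

/-- The elements of `L A` lying strictly above `X` in the intersection poset,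
i.e. the sets `Y ∈ L A` with `Y ⊋ X`. -/
def above (A : Finset (Set (ι → ℝ))) (X : Set (ι → ℝ)) : Finset (Set (ι → ℝ)) :=
  (L A).filter fun Y => X ⊂ Y

lemma above_lt {A : Finset (Set (ι → ℝ))} {X Y : Set (ι → ℝ)}
    (hY : Y ∈ above A X) : (above A Y).card < (above A X).card := by
  have hY' := Finset.mem_filter.mp hY
  apply Finset.card_lt_card
  rw [Finset.ssubset_iff_of_subset]
  · refine ⟨Y, hY, ?_⟩
    simp only [above, Finset.mem_filter, not_and]
    exact fun _ => ssubset_irrefl Y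
  · intro Z hZ
    have hZ' := Finset.mem_filter.mp hZ
    exact Finset.mem_filter.mpr ⟨hZ'.1, hY'.2.trans hZ'.2⟩

/-- The Möbius function of the intersection poset: `μ(whole space) = 1`, and
`μ(X) = - ∑_{Y ⊋ X} μ(Y)`. -/
def mob (A : Finset (Set (ι → ℝ))) (X : Set (ι → ℝ)) : ℤ :=
  if X = Set.univ then 1
  else - ∑ Y ∈ (above A X).attach, mob A Y.1
termination_by (above A X).card
decreasing_by exact above_lt Y.2

/-- The characteristic polynomial `χ_A(t) = ∑_{X ∈ L(A)} μ(X) t^{dim X}`. -/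
def charPoly (A : Finset (Set (ι → ℝ))) : Polynomial ℤ :=
  ∑ X ∈ L A, Polynomial.C (mob A X) * Polynomial.X ^ dim X

/-- The localization `B_X = {H ∈ B : X ⊆ H}`. -/
def loc (B : Finset (Set (ι → ℝ))) (X : Set (ι → ℝ)) : Finset (Set (ι → ℝ)) :=
  B.filter fun H => X ⊆ H

open Pointwise in
/-- `X` is a modular element of `L(B)`: `X ∈ L(B)` and `X + Y ∈ L(B)` for all `Y ∈ L(B)`. -/
def IsModular (B : Finset (Set (ι → ℝ))) (X : Set (ι → ℝ)) : Prop :=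
  X ∈ L B ∧ ∀ Y ∈ L B, X + Y ∈ L B

/-- The rank of an arrangement: maximal codimension of an element of `L(B)`. -/
def rank [Fintype ι] (B : Finset (Set (ι → ℝ))) : ℕ :=
  (L B).sup fun X => Fintype.card ι - dim X

/-- A modular coatom: a modular element of codimension `rank B - 1`. -/
def IsModularCoatom [Fintype ι] (B : Finset (Set (ι → ℝ))) (X : Set (ι → ℝ)) : Prop :=
  IsModular B X ∧ Fintype.card ι - dim X = rank B - 1

/-- A central arrangement is supersolvable if there is a chain of localizations
`∅ = B_{X_0} ⊆ B_{X_1} ⊆ ⋯ ⊆ B_{X_r} = B` (`r = rank B`) in which each `X_i` is a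
modular coatom of `B_{X_{i+1}}`. -/
def IsSupersolvable [Fintype ι] (B : Finset (Set (ι → ℝ))) : Prop :=
  ∃ X : Fin (rank B + 1) → Set (ι → ℝ),
    loc B (X 0) = ∅ ∧ loc B (X (Fin.last (rank B))) = B ∧
    (∀ i j : Fin (rank B + 1), i ≤ j → loc B (X i) ⊆ loc B (X j)) ∧
    ∀ i : Fin (rank B), IsModularCoatom (loc B (X i.succ)) (X i.castSucc)

/-- The polynomial ring `S = ℝ[x_i : i ∈ ι]`. -/
abbrev S (ι : Type) := MvPolynomial ι ℝ

/-- Derivations of `S` over `ℝ`. -/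
abbrev Der (ι : Type) := Derivation ℝ (S ι) (S ι)

/-- The linear polynomial `∑ c_i x_i`. -/
def linPoly [Fintype ι] (c : ι → ℝ) : S ι := ∑ i, MvPolynomial.C (c i) * MvPolynomial.X i

/-- The linear hyperplane `{x : ∑ c_i x_i = 0}`. -/
def linHyp [Fintype ι] (c : ι → ℝ) : Set (ι → ℝ) := {x | ∑ i, c i * x i = 0}

/-- `θ` is a logarithmic derivation of the central arrangement `B`:
`θ(α_H) ∈ α_H S` for every defining linear form `α_H` of every `H ∈ B`. -/
def IsLogDer [Fintype ι] (B : Finset (Set (ι → ℝ))) (θ : Der ι) : Prop :=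
  ∀ c : ι → ℝ, c ≠ 0 → linHyp c ∈ B → linPoly c ∣ θ (linPoly c)

/-- A derivation `θ = ∑ f_j ∂/∂x_j` is homogeneous of degree `d` if every
coefficient `f_j = θ(x_j)` is homogeneous of degree `d`. -/
def IsHomog (θ : Der ι) (d : ℕ) : Prop :=
  ∀ j : ι, MvPolynomial.IsHomogeneous (θ (MvPolynomial.X j)) d

/-- `B` is free with exponents `d`: `D(B)` is a free `S`-module with a homogeneous
basis `θ_i`, `i ∈ ι`, of degrees `d_i`. -/
def IsFreeWith [Fintype ι] (B : Finset (Set (ι → ℝ))) (d : ι → ℕ) : Prop :=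
  ∃ θ : ι → Der ι,
    (∀ i, IsLogDer B (θ i)) ∧ (∀ i, IsHomog (θ i) (d i)) ∧
    ∀ η : Der ι, IsLogDer B η → ∃! f : ι → S ι, η = ∑ i, f i • θ i

/-- `B` is a free arrangement. -/
def IsFree [Fintype ι] (B : Finset (Set (ι → ℝ))) : Prop := ∃ d : ι → ℕ, IsFreeWith B d

/-- Logarithmic derivation of a multiarrangement `(B, mult)`:
`θ(α_H) ∈ α_H^{mult H} S` for every `H ∈ B`. -/
def IsLogDerMulti [Fintype ι] (B : Finset (Set (ι → ℝ))) (mult : Set (ι → ℝ) → ℕ)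
    (θ : Der ι) : Prop :=
  ∀ c : ι → ℝ, c ≠ 0 → linHyp c ∈ B → linPoly c ^ mult (linHyp c) ∣ θ (linPoly c)

/-- Freeness of the multiarrangement `(B, mult)`: `D(B, mult)` is a free `S`-module. -/
def IsFreeMulti [Fintype ι] (B : Finset (Set (ι → ℝ))) (mult : Set (ι → ℝ) → ℕ) : Prop :=
  ∃ θ : ι → Der ι,
    (∀ i, IsLogDerMulti B mult (θ i)) ∧
    ∀ η : Der ι, IsLogDerMulti B mult η → ∃! f : ι → S ι, η = ∑ i, f i • θ i

/-- `B` is locally free in codimension three along the hyperplane `H`: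
every localization at an `X ∈ L(B)` with `X ⊆ H` of codimension 3 is free. -/
def LocallyFree3 [Fintype ι] (B : Finset (Set (ι → ℝ))) (H : Set (ι → ℝ)) : Prop :=
  ∀ X ∈ L B, X ⊆ H → Fintype.card ι - dim X = 3 → IsFree (loc B X)

/-- The ψ-digraphical arrangement `A(G, ψ)` of the digraph with edge set `E` on the
vertex set `ι` and weight `ψ(i) = [a i, b i]`:  hyperplanes `x_i - x_j = 0` for all
distinct `i, j`, `x_i - x_j = 1` for `(i,j) ∈ E`, and `x_i = c` for `c ∈ [a i, b i]`. -/
def digArr [Fintype ι] (E : Finset (ι × ι)) (a b : ι → ℤ) : Finset (Set (ι → ℝ)) :=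
  ((univ.filter fun p : ι × ι => p.1 ≠ p.2).image fun p =>
      {x : ι → ℝ | x p.1 - x p.2 = 0})
  ∪ (E.image fun p => {x : ι → ℝ | x p.1 - x p.2 = 1})
  ∪ (univ.biUnion fun i : ι =>
      (Finset.Icc (a i) (b i)).image fun c => {x : ι → ℝ | x i = (c : ℝ)})

/-- The cone `cA(G, ψ)` over the ψ-digraphical arrangement, a central arrangement in
`ℝ^{ℓ+1}` with coordinates indexed by `Option ι` (the coordinate `z` being `x none`). -/
def coneDigArr [Fintype ι] (E : Finset (ι × ι)) (a b : ι → ℤ) :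
    Finset (Set (Option ι → ℝ)) :=
  ({({x : Option ι → ℝ | x none = 0})} : Finset (Set (Option ι → ℝ)))
  ∪ ((univ.filter fun p : ι × ι => p.1 ≠ p.2).image fun p =>
      {x : Option ι → ℝ | x (some p.1) - x (some p.2) = 0})
  ∪ (E.image fun p => {x : Option ι → ℝ | x (some p.1) - x (some p.2) = x none})
  ∪ (univ.biUnion fun i : ι =>
      (Finset.Icc (a i) (b i)).image fun c =>
        {x : Option ι → ℝ | x (some i) = (c : ℝ) * x none})

/-- The restriction of the edge set `E` to the vertex set `ι ∖ {v}`. -/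
def Eres (E : Finset (ι × ι)) (v : ι) :
    Finset ({i : ι // i ≠ v} × {i : ι // i ≠ v}) :=
  ((E.filter fun e => e.1 ≠ v ∧ e.2 ≠ v).attach).image fun e =>
    (⟨e.1.1, (Finset.mem_filter.mp e.2).2.1⟩, ⟨e.1.2, (Finset.mem_filter.mp e.2).2.2⟩)

/-- The element `X_v ∈ L(cA(G,ψ))`: the intersection of `z = 0`, `x_i - x_j = 0`
(`i, j ≠ v`), `x_i - x_j = z` (edges `(i,j)` with `i, j ≠ v`) and `x_i = cz`
(`i ≠ v`, `c ∈ ψ(i)`). -/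
def Xv (E : Finset (ι × ι)) (a b : ι → ℤ) (v : ι) : Set (Option ι → ℝ) :=
  {x | x none = 0 ∧
    (∀ i j : ι, i ≠ v → j ≠ v → x (some i) - x (some j) = 0) ∧
    (∀ p ∈ E, p.1 ≠ v → p.2 ≠ v → x (some p.1) - x (some p.2) = x none) ∧
    (∀ i : ι, i ≠ v → ∀ c ∈ Finset.Icc (a i) (b i), x (some i) = (c : ℝ) * x none)}

/-- `v` is a simplicial vertex of `(G, ψ)`: `X_v` is a modular coatom of `cA(G,ψ)`. -/
def Simplicial [Fintype ι] (E : Finset (ι × ι)) (a b : ι → ℤ) (v : ι) : Prop :=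
  IsModularCoatom (coneDigArr E a b) (Xv E a b v)

/-- Restriction of a subset of the cone space to the infinite hyperplane `z = 0`,
identified with `ι → ℝ`. -/
def resH (K : Set (Option ι → ℝ)) : Set (ι → ℝ) :=
  {y | (fun o : Option ι => Option.elim o 0 y) ∈ K}

/-- Embedding of a subset of the infinite hyperplane back into the cone space. -/
def embedH (Y : Set (ι → ℝ)) : Set (Option ι → ℝ) :=
  {x | x none = 0 ∧ (fun i : ι => x (some i)) ∈ Y}

/-- The underlying arrangement of the Ziegler restriction of `B` onto the infinite
hyperplane `z = 0`. -/
def zieglerArr (B : Finset (Set (Option ι → ℝ))) : Finset (Set (ι → ℝ)) :=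
  (B.erase {x | x none = 0}).image resH

/-- The Ziegler multiplicity `m^{H_∞}(X) = |{K ∈ B : X ⊆ K}| - 1`. -/
def zieglerMult (B : Finset (Set (Option ι → ℝ))) (Y : Set (ι → ℝ)) : ℕ :=
  (B.filter fun K => embedH Y ⊆ K).card - 1

/-- The (k,ℓ)-Shi-Ish arrangement in `ℝ^ℓ` (0-based vertices `0,…,ℓ-1` standing
for the labels `1,…,ℓ`). -/
def ShiIsh (ℓ k : ℕ) : Finset (Set (Fin ℓ → ℝ)) :=
  ((univ.filter fun p : Fin ℓ × Fin ℓ => p.1 < p.2).image fun p =>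
      {x : Fin ℓ → ℝ | x p.1 - x p.2 = 0})
  ∪ ((univ.filter fun p : Fin ℓ × Fin ℓ => p.1 < p.2 ∧ k ≤ (p.1 : ℕ) + 1).image fun p =>
      {x : Fin ℓ → ℝ | x p.1 - x p.2 = 1})
  ∪ ((univ.filter fun p : Fin ℓ × Fin ℓ => (p.1 : ℕ) = 0).biUnion fun p =>
      ((Finset.Icc 1 ((p.2 : ℕ))).filter fun c => c < k).image fun c =>
        {x : Fin ℓ → ℝ | x p.1 - x p.2 = (c : ℝ)})

/-- The cone over the (k,ℓ)-Shi-Ish arrangement, a central arrangement in `ℝ^{ℓ+1}`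
with coordinates indexed by `Option (Fin ℓ)` (the coordinate `z` being `x none`). -/
def cShiIsh (ℓ k : ℕ) : Finset (Set (Option (Fin ℓ) → ℝ)) :=
  ({({x : Option (Fin ℓ) → ℝ | x none = 0})} : Finset (Set (Option (Fin ℓ) → ℝ)))
  ∪ ((univ.filter fun p : Fin ℓ × Fin ℓ => p.1 < p.2).image fun p =>
      {x : Option (Fin ℓ) → ℝ | x (some p.1) - x (some p.2) = 0})
  ∪ ((univ.filter fun p : Fin ℓ × Fin ℓ => p.1 < p.2 ∧ k ≤ (p.1 : ℕ) + 1).image fun p =>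
      {x : Option (Fin ℓ) → ℝ | x (some p.1) - x (some p.2) = x none})
  ∪ ((univ.filter fun p : Fin ℓ × Fin ℓ => (p.1 : ℕ) = 0).biUnion fun p =>
      ((Finset.Icc 1 ((p.2 : ℕ))).filter fun c => c < k).image fun c =>
        {x : Option (Fin ℓ) → ℝ | x (some p.1) - x (some p.2) = (c : ℝ) * x none})

/-- The digraph `T_ℓ^k` on `ℓ` 0-based vertices, with edges `(i,j)` for `i < j`
with label `(j : ℕ) + 1 ≤ ℓ - k + 1`. -/
def Tlk (ℓ k : ℕ) : Finset (Fin ℓ × Fin ℓ) :=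
  univ.filter fun p : Fin ℓ × Fin ℓ => p.1 < p.2 ∧ (p.2 : ℕ) + 1 ≤ ℓ - k + 1

/-- The lower endpoint of the weight `ψ_ℓ^k(i) = [-min(ℓ-i+1, k), 0]`
(0-based vertex `i` standing for the label `i+1`, so `ℓ - label + 1 = ℓ - i`). -/
def psiLk (ℓ k : ℕ) (i : Fin ℓ) : ℤ := -(min (ℓ - (i : ℕ)) k : ℤ)

end Paper

namespace Paper

section Moebius

variable {ι : Type} {A : Finset (Set (ι → ℝ))} {X : Set (ι → ℝ)}

lemma mem_inter {x : ι → ℝ} : x ∈ inter A ↔ ∀ H ∈ A, x ∈ H := by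
  simp [inter]

lemma mem_L_iff : X ∈ L A ↔ (∃ B ⊆ A, inter B = X) ∧ X.Nonempty := by
  simp [L]

lemma sum_filter_superset {M : Type*} [AddCommMonoid M] (g : Set (ι → ℝ) → M) (hX : X ∈ L A) :
    ∑ Z ∈ (L A).filter (X ⊆ ·), g Z = g X + ∑ Z ∈ above A X, g Z := by
  have h : (L A).filter (X ⊆ ·) = insert X (above A X) := by
    ext Z
    simp only [above, Finset.mem_filter, Finset.mem_insert]
    constructor
    · rintro ⟨h1, h2⟩
      rcases h2.eq_or_ssubset with h | h
      · exact Or.inl h.symm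
      · exact Or.inr ⟨h1, h⟩
    · rintro (rfl | ⟨h1, h2⟩)
      · exact ⟨hX, subset_rfl⟩
      · exact ⟨h1, h2.subset⟩
  rw [h, Finset.sum_insert]
  simp [above]

lemma mob_eq_neg_sum (hX : X ≠ Set.univ) : mob A X = - ∑ Y ∈ above A X, mob A Y := by
  rw [mob, if_neg hX, Finset.sum_attach (above A X) (mob A)]

lemma above_univ : above A Set.univ = ∅ := by
  ext Z
  simp only [above, Finset.mem_filter, Finset.notMem_empty, iff_false, not_and]
  exact fun _ h => h.2 (Set.subset_univ Z)

lemma sum_mob_superset (hX : X ∈ L A) :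
    ∑ Z ∈ (L A).filter (X ⊆ ·), mob A Z = if X = Set.univ then 1 else 0 := by
  rw [sum_filter_superset _ hX]
  split_ifs with h
  · subst h
    rw [above_univ, mob]
    simp
  · rw [mob_eq_neg_sum h]
    simp

/-- The Möbius function is determined by its defining recursion. -/
lemma mob_eq_of_sum (ν : Set (ι → ℝ) → ℤ)
    (hν : ∀ X ∈ L A, ∑ Z ∈ (L A).filter (X ⊆ ·), ν Z = if X = Set.univ then 1 else 0)
    (hX : X ∈ L A) : mob A X = ν X := by
  induction hn : (above A X).card using Nat.strong_induction_on generalizing X with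
  | _ n ih =>
    have h1 := hν X hX
    rw [← sum_mob_superset hX, sum_filter_superset _ hX, sum_filter_superset _ hX,
      Finset.sum_congr (s₁ := above A X) (f := mob A) rfl
        fun Z hZ => ih _ (hn ▸ above_lt hZ) (Finset.mem_filter.mp hZ).1 rfl] at h1
    linarith

end Moebius

section Fibration

variable {ι : Type} (v : ι)

/-- The projection forgetting the coordinate `v`. -/
def proj : (ι → ℝ) →ₗ[ℝ] ({i : ι // i ≠ v} → ℝ) := LinearMap.funLeft ℝ ℝ Subtype.val

/-- The point of `ι → ℝ` with `v`-coordinate `t` and remaining coordinates `y`. -/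
def glue (y : {i : ι // i ≠ v} → ℝ) (t : ℝ) : ι → ℝ :=
  fun i => if h : i = v then t else y ⟨i, h⟩

/-- The graph of `g` over `Y`, along the coordinate `v`. -/
def graphOver (Y : Set ({i : ι // i ≠ v} → ℝ)) (g : ({i : ι // i ≠ v} → ℝ) → ℝ) :
    Set (ι → ℝ) :=
  {x | proj v x ∈ Y ∧ x v = g (proj v x)}

variable {v}

@[simp] lemma proj_apply (x : ι → ℝ) (i : {i : ι // i ≠ v}) : proj v x i = x i := rfl

@[simp] lemma proj_glue (y : {i : ι // i ≠ v} → ℝ) (t : ℝ) : proj v (glue v y t) = y := by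
  ext i
  simp [glue, i.2]

@[simp] lemma glue_self (y : {i : ι // i ≠ v} → ℝ) (t : ℝ) : glue v y t v = t := by
  simp [glue]

lemma glue_proj (x : ι → ℝ) : glue v (proj v x) (x v) = x := by
  ext i
  by_cases h : i = v
  · subst h; simp
  · simp [glue, h]

lemma mem_graphOver {Y : Set ({i : ι // i ≠ v} → ℝ)} {g : ({i : ι // i ≠ v} → ℝ) → ℝ}
    {x : ι → ℝ} : x ∈ graphOver v Y g ↔ proj v x ∈ Y ∧ x v = g (proj v x) :=
  Iff.rfl

lemma proj_surjective : Function.Surjective (proj v) := fun y => ⟨glue v y 0, proj_glue y 0⟩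

lemma image_proj_graphOver (Y : Set ({i : ι // i ≠ v} → ℝ)) (g : ({i : ι // i ≠ v} → ℝ) → ℝ) :
    proj v '' graphOver v Y g = Y := by
  ext y
  constructor
  · rintro ⟨x, hx, rfl⟩
    exact hx.1
  · intro hy
    exact ⟨glue v y (g y), by simp [graphOver, hy], by simp⟩

lemma graphOver_eq_image (Y : Set ({i : ι // i ≠ v} → ℝ)) (g : ({i : ι // i ≠ v} → ℝ) → ℝ) :
    graphOver v Y g = (fun y => glue v y (g y)) '' Y := by
  ext x
  constructor
  · rintro ⟨h1, h2⟩
    exact ⟨_, h1, by simp only [← h2, glue_proj]⟩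
  · rintro ⟨y, hy, rfl⟩
    simp [graphOver, hy]

variable {κ : Type} (A' : Finset (Set ({i : ι // i ≠ v} → ℝ))) (K : Finset κ)
  (f : κ → ({i : ι // i ≠ v} → ℝ) →ᵃ[ℝ] ℝ)

/-- The arrangement consisting of the cylinders over the hyperplanes of `A'` and the graphs
of the affine functions `f k`, `k ∈ K`. -/
def graphArr : Finset (Set (ι → ℝ)) :=
  A'.image (proj v ⁻¹' ·) ∪ K.image fun k => graphOver v Set.univ (f k)

/-- Distinct functions `f k`, `f l` agree nowhere, or on exactly one of the given hyperplanes. -/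
def IsFiberType : Prop :=
  ∀ k ∈ K, ∀ l ∈ K, k ≠ l → f k ≠ f l ∧ ((∃ y, f k y = f l y) → {y | f k y = f l y} ∈ A')

variable {A' K f}

lemma preimage_proj_mem_L {Y : Set ({i : ι // i ≠ v} → ℝ)} (hY : Y ∈ L A') :
    proj v ⁻¹' Y ∈ L (graphArr A' K f) := by
  rw [mem_L_iff] at hY ⊢
  obtain ⟨⟨B, hB, rfl⟩, hne⟩ := hY
  refine ⟨⟨B.image (proj v ⁻¹' ·), ?_, ?_⟩, hne.preimage proj_surjective⟩
  · exact (Finset.image_subset_image hB).trans Finset.subset_union_left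
  · ext x
    simp [mem_inter]

lemma graphOver_mem_L {Y : Set ({i : ι // i ≠ v} → ℝ)} (hY : Y ∈ L A') {k : κ} (hk : k ∈ K) :
    graphOver v Y (f k) ∈ L (graphArr A' K f) := by
  rw [mem_L_iff] at hY ⊢
  obtain ⟨⟨B, hB, rfl⟩, hne⟩ := hY
  refine ⟨⟨insert (graphOver v Set.univ (f k)) (B.image (proj v ⁻¹' ·)), ?_, ?_⟩, ?_⟩
  · rw [Finset.insert_subset_iff]
    exact ⟨Finset.mem_union_right _ (Finset.mem_image_of_mem _ hk),
      (Finset.image_subset_image hB).trans Finset.subset_union_left⟩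
  · ext x
    simp [mem_inter, graphOver, and_comm]
  · rw [graphOver_eq_image]
    exact hne.image _

lemma mem_L_graphArr_iff (hK : IsFiberType A' K f) {Z : Set (ι → ℝ)} :
    Z ∈ L (graphArr A' K f) ↔
      ∃ Y ∈ L A', Z = proj v ⁻¹' Y ∨ ∃ k ∈ K, Z = graphOver v Y (f k) := by
  constructor
  · intro hZ
    rw [mem_L_iff] at hZ
    obtain ⟨⟨B, hB, rfl⟩, x₀, hx₀⟩ := hZ
    rw [mem_inter] at hx₀
    by_cases hk : ∃ k ∈ K, graphOver v Set.univ (f k) ∈ B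
    · obtain ⟨k, hk, hkB⟩ := hk
      have hval : ∀ l ∈ K, graphOver v Set.univ (f l) ∈ B → f l (proj v x₀) = x₀ v :=
        fun l _ h => ((hx₀ _ h).2).symm
      refine ⟨inter (A'.filter fun H => (proj v ⁻¹' H) ∈ B ∨
        ∃ l ∈ K, graphOver v Set.univ (f l) ∈ B ∧ H = {y | f k y = f l y}), ?_, Or.inr ⟨k, hk, ?_⟩⟩
      · rw [mem_L_iff]
        refine ⟨⟨_, Finset.filter_subset _ _, rfl⟩, proj v x₀, ?_⟩
        rw [mem_inter]
        intro H hH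
        rcases (Finset.mem_filter.mp hH).2 with h | ⟨l, hl, hlB, rfl⟩
        · exact hx₀ _ h
        · simp [hval k hk hkB, hval l hl hlB]
      · ext x
        simp only [mem_graphOver, mem_inter, Finset.mem_filter]
        constructor
        · intro hx
          have hxk := (hx _ hkB).2
          refine ⟨?_, hxk⟩
          rintro H ⟨-, h | ⟨l, hl, hlB, rfl⟩⟩
          · exact hx _ h
          · exact hxk.symm.trans (hx _ hlB).2
        · rintro ⟨h1, h2⟩ H hH
          rcases Finset.mem_union.mp (hB hH) with h | h
          · obtain ⟨H', hH', rfl⟩ := Finset.mem_image.mp h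
            exact h1 H' ⟨hH', Or.inl hH⟩
          · obtain ⟨l, hl, rfl⟩ := Finset.mem_image.mp h
            refine ⟨trivial, ?_⟩
            by_cases hkl : k = l
            · rwa [← hkl]
            · have := (hK k hk l hl hkl).2
                ⟨proj v x₀, by rw [hval k hk hkB, hval l hl hH]⟩
              rw [h2]
              exact h1 _ ⟨this, Or.inr ⟨l, hl, hH, rfl⟩⟩
    · push Not at hk
      refine ⟨inter (A'.filter fun H => (proj v ⁻¹' H) ∈ B), ?_, Or.inl ?_⟩
      · rw [mem_L_iff]
        refine ⟨⟨_, Finset.filter_subset _ _, rfl⟩, proj v x₀, ?_⟩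
        rw [mem_inter]
        intro H hH
        exact hx₀ _ (Finset.mem_filter.mp hH).2
      · ext x
        simp only [Set.mem_preimage, mem_inter, Finset.mem_filter]
        constructor
        · rintro hx H ⟨-, h⟩
          exact hx _ h
        · intro h1 H hH
          rcases Finset.mem_union.mp (hB hH) with h | h
          · obtain ⟨H', hH', rfl⟩ := Finset.mem_image.mp h
            exact h1 H' ⟨hH', hH⟩
          · obtain ⟨l, hl, rfl⟩ := Finset.mem_image.mp h
            exact absurd hH (hk l hl)
  · rintro ⟨Y, hY, rfl | ⟨k, hk, rfl⟩⟩
    · exact preimage_proj_mem_L hY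
    · exact graphOver_mem_L hY hk

variable (K f) in
/-- The indices of the graphs containing `Z`. -/
def graphsThrough (Z : Set (ι → ℝ)) : Finset κ :=
  K.filter fun k => Z ⊆ graphOver v Set.univ (f k)

lemma graphsThrough_preimage {Y : Set ({i : ι // i ≠ v} → ℝ)} (hY : Y.Nonempty) :
    graphsThrough K f (proj v ⁻¹' Y) = ∅ := by
  obtain ⟨y, hy⟩ := hY
  rw [graphsThrough, Finset.filter_eq_empty_iff]
  intro k _ h
  have : glue v y (f k y + 1) ∈ proj v ⁻¹' Y := by simpa using hy
  have := (h this).2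
  simp at this

lemma graphOver_subset_graphOver {Y : Set ({i : ι // i ≠ v} → ℝ)} {k l : κ} :
    graphOver v Y (f k) ⊆ graphOver v Set.univ (f l) ↔
      graphOver v Y (f l) = graphOver v Y (f k) := by
  constructor
  · intro h
    have hy : ∀ y ∈ Y, f k y = f l y := fun y hy => by
      have : glue v y (f k y) ∈ graphOver v Y (f k) := by simpa [graphOver] using hy
      simpa [graphOver] using h this
    ext x
    simp only [mem_graphOver]
    exact and_congr_right fun hx => by rw [hy _ hx]
  · intro h
    rw [← h]
    exact fun x hx => ⟨trivial, hx.2⟩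

lemma graphsThrough_graphOver_nonempty {Y : Set ({i : ι // i ≠ v} → ℝ)} {k : κ} (hk : k ∈ K) :
    (graphsThrough K f (graphOver v Y (f k))).Nonempty :=
  ⟨k, Finset.mem_filter.mpr ⟨hk, fun _ hx => ⟨trivial, hx.2⟩⟩⟩

lemma nonempty_of_mem_L {ι : Type} {A : Finset (Set (ι → ℝ))} {Y : Set (ι → ℝ)} (hY : Y ∈ L A) :
    Y.Nonempty :=
  (mem_L_iff.mp hY).2

/-- Summation over the elements of the intersection poset of a fiber-type arrangement. -/
lemma sum_L_graphArr (hK : IsFiberType A' K f) {M : Type*} [AddCommMonoid M]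
    (p q : Set ({i : ι // i ≠ v} → ℝ) → M) (X : Set (ι → ℝ)) :
    ∑ Z ∈ (L (graphArr A' K f)).filter (X ⊆ ·),
        (if graphsThrough K f Z = ∅ then p (proj v '' Z)
          else (graphsThrough K f Z).card • q (proj v '' Z))
      = ∑ Y ∈ (L A').filter (proj v '' X ⊆ ·), (p Y + (graphsThrough K f X).card • q Y) := by
  have hsplit : (L (graphArr A' K f)).filter (X ⊆ ·) =
      ((L A').filter (proj v '' X ⊆ ·)).image (proj v ⁻¹' ·) ∪
      ((L A').filter (proj v '' X ⊆ ·)).biUnion fun Y =>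
        (graphsThrough K f X).image fun k => graphOver v Y (f k) := by
    ext Z
    simp only [Finset.mem_filter, mem_L_graphArr_iff hK, Finset.mem_union, Finset.mem_image,
      Finset.mem_biUnion, graphsThrough, Set.image_subset_iff]
    constructor
    · rintro ⟨⟨Y, hY, rfl | ⟨k, hk, rfl⟩⟩, hX⟩
      · exact Or.inl ⟨Y, ⟨hY, hX⟩, rfl⟩
      · exact Or.inr ⟨Y, ⟨hY, fun x hx => (hX hx).1⟩, k,
          ⟨hk, fun x hx => ⟨trivial, (hX hx).2⟩⟩, rfl⟩
    · rintro (⟨Y, ⟨hY, hX⟩, rfl⟩ | ⟨Y, ⟨hY, hX⟩, k, ⟨hk, hXk⟩, rfl⟩)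
      · exact ⟨⟨Y, hY, Or.inl rfl⟩, hX⟩
      · exact ⟨⟨Y, hY, Or.inr ⟨k, hk, rfl⟩⟩, fun x hx => ⟨hX hx, (hXk hx).2⟩⟩
  rw [hsplit, Finset.sum_union, Finset.sum_image, Finset.sum_biUnion, Finset.sum_add_distrib]
  · congr 1
    · refine Finset.sum_congr rfl fun Y hY => ?_
      rw [if_pos (graphsThrough_preimage (nonempty_of_mem_L (Finset.mem_filter.mp hY).1)),
        Set.image_preimage_eq _ proj_surjective]
    · refine Finset.sum_congr rfl fun Y hY => ?_
      have hXY := (Finset.mem_filter.mp hY).2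
      rw [← Finset.sum_const, ← Finset.sum_congr rfl fun k _ =>
        congrArg q (image_proj_graphOver Y (f k)),
        Finset.sum_comp (fun Z => q (proj v '' Z)) fun k => graphOver v Y (f k)]
      refine Finset.sum_congr rfl fun Z hZ => ?_
      obtain ⟨k, hk, rfl⟩ := Finset.mem_image.mp hZ
      have hk' := Finset.mem_filter.mp hk
      rw [if_neg (graphsThrough_graphOver_nonempty hk'.1).ne_empty]
      congr 2
      ext l
      simp only [graphsThrough, Finset.mem_filter, graphOver_subset_graphOver]
      constructor
      · rintro ⟨hl, h⟩
        refine ⟨⟨hl, fun x hx => ?_⟩, h⟩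
        have : x ∈ graphOver v Y (f k) := ⟨hXY ⟨x, hx, rfl⟩, (hk'.2 hx).2⟩
        rw [← h] at this
        exact ⟨trivial, this.2⟩
      · rintro ⟨⟨hl, -⟩, h⟩
        exact ⟨hl, h⟩
  · intro Y _ Y' _ hne
    rw [Function.onFun, Finset.disjoint_left]
    rintro Z hZ hZ'
    obtain ⟨k, -, rfl⟩ := Finset.mem_image.mp hZ
    obtain ⟨l, -, h⟩ := Finset.mem_image.mp hZ'
    apply hne
    rw [← image_proj_graphOver Y (f k), ← h, image_proj_graphOver]
  · intro Y _ Y' _ h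
    exact proj_surjective.preimage_injective h
  · rw [Finset.disjoint_left]
    rintro Z hZ hZ'
    obtain ⟨Y, hY, rfl⟩ := Finset.mem_image.mp hZ
    obtain ⟨Y', -, hY'⟩ := Finset.mem_biUnion.mp hZ'
    obtain ⟨k, hk, h⟩ := Finset.mem_image.mp hY'
    have h1 := graphsThrough_graphOver_nonempty (Y := Y') (f := f) (Finset.mem_filter.mp hk).1
    rw [h, graphsThrough_preimage (nonempty_of_mem_L (Finset.mem_filter.mp hY).1)] at h1
    exact Finset.not_nonempty_empty h1

lemma univ_mem_L {ι : Type} (A : Finset (Set (ι → ℝ))) : Set.univ ∈ L A :=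
  mem_L_iff.mpr ⟨⟨∅, Finset.empty_subset _, by simp [inter]⟩, Set.univ_nonempty⟩

lemma mob_graphArr (hK : IsFiberType A' K f) {Z : Set (ι → ℝ)} (hZ : Z ∈ L (graphArr A' K f)) :
    mob (graphArr A' K f) Z =
      if graphsThrough K f Z = ∅ then mob A' (proj v '' Z)
        else (graphsThrough K f Z).card • -mob A' (proj v '' Z) := by
  refine mob_eq_of_sum (fun Z => if graphsThrough K f Z = ∅ then mob A' (proj v '' Z)
        else (graphsThrough K f Z).card • -mob A' (proj v '' Z)) (fun X hX => ?_) hZ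
  rw [sum_L_graphArr hK (mob A') (fun Y => - mob A' Y)]
  obtain ⟨Y, hY, rfl | ⟨k, hk, rfl⟩⟩ := (mem_L_graphArr_iff hK).mp hX
  · rw [graphsThrough_preimage (nonempty_of_mem_L hY), Set.image_preimage_eq _ proj_surjective]
    simp only [Finset.card_empty, zero_smul, add_zero]
    rw [sum_mob_superset hY]
    congr 1
    rw [← Set.preimage_univ (f := proj v), proj_surjective.preimage_injective.eq_iff]
  · rw [image_proj_graphOver, if_neg]
    · have : ∀ Y', mob A' Y' + (graphsThrough K f (graphOver v Y (f k))).card • -mob A' Y' =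
          (1 - (graphsThrough K f (graphOver v Y (f k))).card : ℤ) * mob A' Y' := by
        intro Y'
        rw [nsmul_eq_mul]
        ring
      simp only [this]
      rw [← Finset.mul_sum, sum_mob_superset hY]
      split_ifs with h
      · subst h
        have : graphsThrough K f (graphOver v Set.univ (f k)) = {k} := by
          ext l
          simp only [graphsThrough, Finset.mem_filter, Finset.mem_singleton]
          constructor
          · rintro ⟨hl, h⟩
            by_contra hne
            refine (hK k hk l hl (Ne.symm hne)).1 (AffineMap.ext fun y => ?_)
            have : glue v y (f k y) ∈ graphOver v Set.univ (f k) := by simp [graphOver]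
            simpa [graphOver] using h this
          · rintro rfl
            exact ⟨hk, subset_rfl⟩
        simp [this]
      · simp
    · intro h
      have := graphsThrough_graphOver_nonempty (f := f) (Y := Y) hk
      rw [h, ← Set.preimage_univ (f := proj v), graphsThrough_preimage Set.univ_nonempty] at this
      exact Finset.not_nonempty_empty this

/-- The affine section of the projection given by an affine function `g`. -/
def affineSection (g : ({i : ι // i ≠ v} → ℝ) →ᵃ[ℝ] ℝ) : ({i : ι // i ≠ v} → ℝ) →ᵃ[ℝ] (ι → ℝ) where
  toFun y := glue v y (g y)
  linear := LinearMap.pi fun i => if h : i = v then g.linear else LinearMap.proj ⟨i, h⟩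
  map_vadd' y w := by
    ext i
    by_cases h : i = v <;> simp [glue, h, -vadd_eq_add, AffineMap.map_vadd]

lemma dim_graphOver (Y : Set ({i : ι // i ≠ v} → ℝ)) (g : ({i : ι // i ≠ v} → ℝ) →ᵃ[ℝ] ℝ) :
    dim (graphOver v Y g) = dim Y := by
  have hinj : Function.Injective (affineSection g) := fun y y' h => by
    have := congrArg (proj v) h
    simpa [affineSection] using this
  have : graphOver v Y g = affineSection g '' Y := graphOver_eq_image Y g
  rw [dim, dim, this, ← AffineSubspace.map_span, AffineSubspace.map_direction]
  exact (Submodule.equivMapOfInjective _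
    ((affineSection g).linear_injective_iff.mpr hinj) _).finrank_eq.symm

lemma dim_preimage_proj [Finite ι] {Y : Set ({i : ι // i ≠ v} → ℝ)} (hY : Y.Nonempty) :
    dim (proj v ⁻¹' Y) = dim Y + 1 := by
  have := Fintype.ofFinite ι
  obtain ⟨y₀, hy₀⟩ := hY
  have hmap : (vectorSpan ℝ (proj v ⁻¹' Y)).map (proj v) = vectorSpan ℝ Y := by
    have := AffineMap.map_vectorSpan (proj v).toAffineMap (s := proj v ⁻¹' Y)
    rwa [LinearMap.toAffineMap_linear, LinearMap.coe_toAffineMap,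
      Set.image_preimage_eq _ proj_surjective] at this
  have hmem : ∀ x, x ∈ vectorSpan ℝ (proj v ⁻¹' Y) ↔ proj v x ∈ vectorSpan ℝ Y := by
    intro x
    rw [← hmap]
    refine ⟨fun h => Submodule.mem_map_of_mem h, fun h => ?_⟩
    obtain ⟨w, hw, hwx⟩ := h
    have h1 : (glue v y₀ 0 + (x - w)) -ᵥ glue v y₀ 0 ∈ vectorSpan ℝ (proj v ⁻¹' Y) :=
      vsub_mem_vectorSpan ℝ (by simp [hwx, hy₀]) (by simp [hy₀])
    simpa using add_mem h1 hw
  let e : vectorSpan ℝ (proj v ⁻¹' Y) ≃ₗ[ℝ] vectorSpan ℝ Y × ℝ :=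
    { toFun x := (⟨proj v x, (hmem x).mp x.2⟩, x.1 v)
      invFun p := ⟨glue v p.1 p.2, (hmem _).mpr (by simp)⟩
      map_add' x y := by ext <;> simp
      map_smul' c x := by ext <;> simp
      left_inv x := by ext1; exact glue_proj _
      right_inv p := Prod.ext (Subtype.ext (proj_glue _ _)) (glue_self _ _) }
  rw [dim, dim, direction_affineSpan, direction_affineSpan, e.finrank_eq, Module.finrank_prod,
    Module.finrank_self]

/-- The characteristic polynomial of a fiber-type arrangement. -/
theorem charPoly_graphArr [Finite ι] (hK : IsFiberType A' K f) :
    charPoly (graphArr A' K f) =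
      (Polynomial.X - Polynomial.C (K.card : ℤ)) * charPoly A' := by
  have h := sum_L_graphArr hK (fun Y => Polynomial.C (mob A' Y) * Polynomial.X ^ (dim Y + 1))
    (fun Y => -(Polynomial.C (mob A' Y) * Polynomial.X ^ dim Y)) ∅
  have hK0 : graphsThrough K f ∅ = K := by simp [graphsThrough]
  simp only [Set.empty_subset, Set.image_empty, Finset.filter_true, hK0] at h
  rw [charPoly, charPoly, Finset.mul_sum]
  refine Eq.trans (Finset.sum_congr rfl fun Z hZ => ?_)
    (h.trans (Finset.sum_congr rfl fun Y _ => ?_))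
  · rw [mob_graphArr hK hZ]
    obtain ⟨Y, hY, rfl | ⟨k, hk, rfl⟩⟩ := (mem_L_graphArr_iff hK).mp hZ
    · have hne := nonempty_of_mem_L hY
      rw [if_pos (graphsThrough_preimage hne), if_pos (graphsThrough_preimage hne),
        Set.image_preimage_eq _ proj_surjective, dim_preimage_proj hne]
    · have := (graphsThrough_graphOver_nonempty (f := f) (Y := Y) hk).ne_empty
      rw [if_neg this, if_neg this, image_proj_graphOver, dim_graphOver]
      simp [mul_assoc]
  · simp
    ring

end Fibration

section Digraphical

variable {ι : Type} (v : ι)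

/-- The affine function `y ↦ y j + c` (for `k = (some j, c)`) or `y ↦ c` (for `k = (none, c)`). -/
def affForm (k : Option {i : ι // i ≠ v} × ℤ) : ({i : ι // i ≠ v} → ℝ) →ᵃ[ℝ] ℝ :=
  (k.1.elim 0 fun j => (LinearMap.proj j : ({i : ι // i ≠ v} → ℝ) →ₗ[ℝ] ℝ)).toAffineMap
    + AffineMap.const ℝ _ (k.2 : ℝ)

/-- The homogenization of `affForm`, as a linear form on the cone space. -/
def linForm (k : Option {i : ι // i ≠ v} × ℤ) : (Option ι → ℝ) →ₗ[ℝ] ℝ :=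
  (k.1.elim 0 fun j => (LinearMap.proj (some j.1) : (Option ι → ℝ) →ₗ[ℝ] ℝ))
    + (k.2 : ℝ) • LinearMap.proj none

/-- The point of the cone space at height `z = 1`, with `v`-coordinate `0`, above `y`. -/
def homog (y : {i : ι // i ≠ v} → ℝ) : Option ι → ℝ := fun o => o.elim 1 (glue v y 0)

variable {v}

@[simp] lemma affForm_some (j : {i : ι // i ≠ v}) (c : ℤ) (y : {i : ι // i ≠ v} → ℝ) :
    affForm v (some j, c) y = y j + c := by
  simp [affForm]

@[simp] lemma affForm_none (c : ℤ) (y : {i : ι // i ≠ v} → ℝ) :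
    affForm v (none, c) y = c := by
  simp [affForm]

@[simp] lemma linForm_some (j : {i : ι // i ≠ v}) (c : ℤ) (x : Option ι → ℝ) :
    linForm v (some j, c) x = x (some j) + c * x none := by
  simp [linForm]

@[simp] lemma linForm_none (c : ℤ) (x : Option ι → ℝ) :
    linForm v (none, c) x = c * x none := by
  simp [linForm]

@[simp] lemma homog_none (y : {i : ι // i ≠ v} → ℝ) : homog v y none = 1 := rfl

@[simp] lemma homog_some (y : {i : ι // i ≠ v} → ℝ) (i : {i : ι // i ≠ v}) :
    homog v y (some i) = y i := by
  simp [homog, glue, i.2]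

lemma linForm_homog (k : Option {i : ι // i ≠ v} × ℤ) (y : {i : ι // i ≠ v} → ℝ) :
    linForm v k (homog v y) = affForm v k y := by
  obtain ⟨_ | j, c⟩ := k <;> simp

lemma affForm_injective : Function.Injective (affForm v) := by
  rintro ⟨o, c⟩ ⟨o', c'⟩ h
  have h0 := DFunLike.congr_fun h 0
  have hc : c = c' := by
    rcases o with _ | j <;> rcases o' with _ | j' <;> simpa using h0
  subst hc
  rcases o with _ | j <;> rcases o' with _ | j'
  · rfl
  · have := DFunLike.congr_fun h (Pi.single j' 1)
    simp at this
  · have := DFunLike.congr_fun h (Pi.single j 1)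
    simp at this
  · have := DFunLike.congr_fun h (Pi.single j 1)
    simp only [affForm_some, Pi.single_eq_same, add_left_inj] at this
    by_cases hj : j' = j
    · rw [hj]
    · simp [hj] at this

lemma mem_Eres {E : Finset (ι × ι)} {i j : {i : ι // i ≠ v}} :
    (i, j) ∈ Eres E v ↔ (i.1, j.1) ∈ E := by
  simp only [Eres, Finset.mem_image, Finset.mem_attach, true_and, Subtype.exists,
    Finset.mem_filter, Prod.mk.injEq]
  constructor
  · rintro ⟨e, ⟨he, -⟩, rfl, rfl⟩
    exact he
  · intro h
    exact ⟨(i.1, j.1), ⟨h, i.2, j.2⟩, rfl, rfl⟩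

variable {E : Finset (ι × ι)} {a b : ι → ℤ}

lemma single_mem_Xv : (Pi.single (some v) 1 : Option ι → ℝ) ∈ Xv E a b v := by
  exact ⟨by simp, fun i j hi hj => by simp [hi, hj], fun p _ hi hj => by simp [hi, hj],
    fun i hi c _ => by simp [hi]⟩

lemma zero_mem_Xv : (0 : Option ι → ℝ) ∈ Xv E a b v := by
  simp [Xv]

variable [Fintype ι]

lemma mem_digArr {H : Set (ι → ℝ)} :
    H ∈ digArr E a b ↔ (∃ i j, i ≠ j ∧ {x : ι → ℝ | x i - x j = 0} = H) ∨
      (∃ i j, (i, j) ∈ E ∧ {x : ι → ℝ | x i - x j = 1} = H) ∨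
      ∃ i, ∃ c ∈ Finset.Icc (a i) (b i), {x : ι → ℝ | x i = (c : ℝ)} = H := by
  simp [digArr]

lemma mem_coneDigArr {H : Set (Option ι → ℝ)} :
    H ∈ coneDigArr E a b ↔ {x : Option ι → ℝ | x none = 0} = H ∨
      (∃ i j, i ≠ j ∧ {x : Option ι → ℝ | x (some i) - x (some j) = 0} = H) ∨
      (∃ i j, (i, j) ∈ E ∧ {x : Option ι → ℝ | x (some i) - x (some j) = x none} = H) ∨
      ∃ i, ∃ c ∈ Finset.Icc (a i) (b i),
        {x : Option ι → ℝ | x (some i) = (c : ℝ) * x none} = H := by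
  simp [coneDigArr, eq_comm (a := H)]

variable (E a b v) in
/-- The indices of the affine functions whose graphs are the hyperplanes involving `x_v`. -/
def pencil : Finset (Option {i : ι // i ≠ v} × ℤ) :=
  (univ.image fun j => (some j, 0)) ∪
  ((univ.filter fun j : {i : ι // i ≠ v} => (v, j.1) ∈ E).image fun j => (some j, 1)) ∪
  ((univ.filter fun j : {i : ι // i ≠ v} => (j.1, v) ∈ E).image fun j => (some j, -1)) ∪
  ((Finset.Icc (a v) (b v)).image fun c => (none, c))

lemma mem_pencil {k : Option {i : ι // i ≠ v} × ℤ} :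
    k ∈ pencil v E a b ↔ (∃ j, (some j, 0) = k) ∨
      (∃ j : {i : ι // i ≠ v}, (v, j.1) ∈ E ∧ (some j, 1) = k) ∨
      (∃ j : {i : ι // i ≠ v}, (j.1, v) ∈ E ∧ (some j, -1) = k) ∨
      ∃ c ∈ Finset.Icc (a v) (b v), (none, c) = k := by
  simp [pencil]

lemma card_pencil (hE : ∀ e ∈ E, e.1 ≠ e.2) :
    (pencil v E a b).card = (Finset.Icc (a v) (b v)).card
      + (E.filter fun e => e.1 = v ∨ e.2 = v).card + Fintype.card ι - 1 := by
  have hout : (E.filter fun e => e.1 = v) =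
      (univ.filter fun j : {i : ι // i ≠ v} => (v, j.1) ∈ E).image fun j => (v, j.1) := by
    ext ⟨i, j⟩
    simp only [Finset.mem_filter, Finset.mem_image, Finset.mem_univ, true_and, Prod.mk.injEq]
    constructor
    · rintro ⟨h, rfl⟩
      exact ⟨⟨j, (hE _ h).symm⟩, h, rfl, rfl⟩
    · rintro ⟨j, h, rfl, rfl⟩
      exact ⟨h, rfl⟩
  have hin : (E.filter fun e => e.2 = v) =
      (univ.filter fun j : {i : ι // i ≠ v} => (j.1, v) ∈ E).image fun j => (j.1, v) := by
    ext ⟨i, j⟩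
    simp only [Finset.mem_filter, Finset.mem_image, Finset.mem_univ, true_and, Prod.mk.injEq]
    constructor
    · rintro ⟨h, rfl⟩
      exact ⟨⟨i, hE _ h⟩, h, rfl, rfl⟩
    · rintro ⟨j, h, rfl, rfl⟩
      exact ⟨h, rfl⟩
  have hdisj : Disjoint (E.filter fun e => e.1 = v) (E.filter fun e => e.2 = v) := by
    rw [Finset.disjoint_filter]
    intro e he h1 h2
    exact hE e he (h1.trans h2.symm)
  have hpos : 0 < Fintype.card ι := Fintype.card_pos_iff.mpr ⟨v⟩
  rw [Finset.filter_or, Finset.card_union_of_disjoint hdisj, hout, hin,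
    Finset.card_image_of_injective, Finset.card_image_of_injective, pencil,
    Finset.card_union_of_disjoint, Finset.card_union_of_disjoint, Finset.card_union_of_disjoint,
    Finset.card_image_of_injective, Finset.card_image_of_injective,
    Finset.card_image_of_injective, Finset.card_image_of_injective, Finset.card_univ,
    Fintype.card_subtype_compl, Fintype.card_subtype_eq]
  · omega
  any_goals
    intro x y h
    simpa [Subtype.ext_iff] using h
  all_goals
    rw [Finset.disjoint_left]
    rintro ⟨_ | j, c⟩ <;> simp <;> grind

lemma digArr_eq_graphArr (hE : ∀ e ∈ E, e.1 ≠ e.2) :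
    digArr E a b = graphArr (digArr (Eres E v) (fun i => a i.1) (fun i => b i.1))
      (pencil v E a b) (affForm v) := by
  ext H
  rw [graphArr, Finset.mem_union, Finset.mem_image, Finset.mem_image, mem_digArr]
  simp only [mem_digArr, mem_pencil]
  constructor
  · rintro (⟨i, j, hij, rfl⟩ | ⟨i, j, hij, rfl⟩ | ⟨i, c, hc, rfl⟩)
    · by_cases hi : i = v
      · subst hi
        refine Or.inr ⟨_, Or.inl ⟨⟨j, hij.symm⟩, rfl⟩, ?_⟩
        ext x
        simp [mem_graphOver, sub_eq_zero]
      · by_cases hj : j = v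
        · subst hj
          refine Or.inr ⟨_, Or.inl ⟨⟨i, hij⟩, rfl⟩, ?_⟩
          ext x
          simp [mem_graphOver, sub_eq_zero, eq_comm]
        · exact Or.inl ⟨_, Or.inl ⟨⟨i, hi⟩, ⟨j, hj⟩, by simpa using hij, rfl⟩, rfl⟩
    · have hne : i ≠ j := hE _ hij
      by_cases hi : i = v
      · subst hi
        refine Or.inr ⟨_, Or.inr (Or.inl ⟨⟨j, hne.symm⟩, hij, rfl⟩), ?_⟩
        ext x
        simp [mem_graphOver, sub_eq_iff_eq_add']
      · by_cases hj : j = v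
        · subst hj
          refine Or.inr ⟨_, Or.inr (Or.inr (Or.inl ⟨⟨i, hi⟩, hij, rfl⟩)), ?_⟩
          ext x
          simp only [mem_graphOver, affForm_some, proj_apply, Set.mem_univ, true_and]
          constructor <;> intro h <;> simp at h ⊢ <;> linarith
        · exact Or.inl ⟨_, Or.inr (Or.inl ⟨⟨i, hi⟩, ⟨j, hj⟩, mem_Eres.mpr hij, rfl⟩), rfl⟩
    · by_cases hi : i = v
      · subst hi
        refine Or.inr ⟨_, Or.inr (Or.inr (Or.inr ⟨c, hc, rfl⟩)), ?_⟩
        ext x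
        simp [mem_graphOver]
      · exact Or.inl ⟨_, Or.inr (Or.inr ⟨⟨i, hi⟩, c, hc, rfl⟩), rfl⟩
  · rintro (⟨_, ⟨i, j, hij, rfl⟩ | ⟨i, j, hij, rfl⟩ | ⟨i, c, hc, rfl⟩, rfl⟩ |
      ⟨_, ⟨j, rfl⟩ | ⟨j, hj, rfl⟩ | ⟨j, hj, rfl⟩ | ⟨c, hc, rfl⟩, rfl⟩)
    · exact Or.inl ⟨i, j, by simpa [Subtype.ext_iff] using hij, rfl⟩
    · exact Or.inr (Or.inl ⟨i, j, mem_Eres.mp hij, rfl⟩)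
    · exact Or.inr (Or.inr ⟨i, c, hc, rfl⟩)
    · refine Or.inl ⟨v, j, j.2.symm, ?_⟩
      ext x
      simp [mem_graphOver, sub_eq_zero]
    · refine Or.inr (Or.inl ⟨v, j, hj, ?_⟩)
      ext x
      simp [mem_graphOver, sub_eq_iff_eq_add']
    · refine Or.inr (Or.inl ⟨j, v, hj, ?_⟩)
      ext x
      simp only [mem_graphOver, affForm_some, proj_apply, Set.mem_univ, true_and]
      constructor <;> intro h <;> simp at h ⊢ <;> linarith
    · refine Or.inr (Or.inr ⟨v, c, hc, ?_⟩)
      ext x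
      simp [mem_graphOver]

lemma linForm_hyperplane_mem_coneDigArr {k : Option {i : ι // i ≠ v} × ℤ}
    (hk : k ∈ pencil v E a b) : {x | x (some v) = linForm v k x} ∈ coneDigArr E a b := by
  rw [mem_coneDigArr]
  rcases mem_pencil.mp hk with ⟨j, rfl⟩ | ⟨j, hj, rfl⟩ | ⟨j, hj, rfl⟩ | ⟨c, hc, rfl⟩
  · refine Or.inr (Or.inl ⟨v, j, j.2.symm, ?_⟩)
    ext x
    simp [sub_eq_zero]
  · refine Or.inr (Or.inr (Or.inl ⟨v, j, hj, ?_⟩))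
    ext x
    simp [sub_eq_iff_eq_add']
  · refine Or.inr (Or.inr (Or.inl ⟨j, v, hj, ?_⟩))
    ext x
    constructor <;> intro h <;> simp at h ⊢ <;> linarith
  · refine Or.inr (Or.inr (Or.inr ⟨v, c, hc, ?_⟩))
    ext x
    simp

/-- Every hyperplane of the cone is a proper linear subspace. -/
lemma exists_submodule_of_mem_coneDigArr {H : Set (Option ι → ℝ)} (hE : ∀ e ∈ E, e.1 ≠ e.2)
    (hH : H ∈ coneDigArr E a b) : ∃ W : Submodule ℝ (Option ι → ℝ), (W : Set _) = H ∧ W ≠ ⊤ := by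
  have key : ∀ (φ : (Option ι → ℝ) →ₗ[ℝ] ℝ) (x : Option ι → ℝ), φ x ≠ 0 →
      ∃ W : Submodule ℝ (Option ι → ℝ), (W : Set _) = {x | φ x = 0} ∧ W ≠ ⊤ := by
    refine fun φ x hx => ⟨LinearMap.ker φ, rfl, fun h => hx ?_⟩
    rw [← LinearMap.mem_ker, h]
    trivial
  let coord : Option ι → (Option ι → ℝ) →ₗ[ℝ] ℝ := LinearMap.proj
  rcases mem_coneDigArr.mp hH with rfl | ⟨i, j, hij, rfl⟩ | ⟨i, j, hij, rfl⟩ | ⟨i, c, hc, rfl⟩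
  · exact key (coord none) 1 (by simp [coord])
  · refine key (coord (some i) - coord (some j)) (Pi.single (some i) 1) ?_
    rw [LinearMap.sub_apply]
    simp [coord, hij]
  · obtain ⟨W, hW, h⟩ := key (coord (some i) - coord (some j) - coord none)
      (Pi.single (some i) 1) (by
        have : i ≠ j := hE _ hij
        simp [coord, LinearMap.sub_apply, this])
    refine ⟨W, hW.trans ?_, h⟩
    ext x
    simp [coord, LinearMap.sub_apply, sub_eq_zero]
  · obtain ⟨W, hW, h⟩ := key (coord (some i) - (c : ℝ) • coord none)
      (Pi.single (some i) 1) (by simp [coord])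
    refine ⟨W, hW.trans ?_, h⟩
    ext x
    simp [coord, LinearMap.sub_apply, sub_eq_zero]

/-- A hyperplane of the cone parallel to the `v`-axis is the infinite hyperplane or comes from
the restriction to `ι ∖ {v}`. -/
lemma eq_infinite_or_of_single_mem {H : Set (Option ι → ℝ)} (hE : ∀ e ∈ E, e.1 ≠ e.2)
    (hH : H ∈ coneDigArr E a b) (hv : (Pi.single (some v) 1 : Option ι → ℝ) ∈ H) :
    H = {x | x none = 0} ∨
      homog v ⁻¹' H ∈ digArr (Eres E v) (fun i => a i.1) (fun i => b i.1) := by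
  rw [mem_digArr]
  rcases mem_coneDigArr.mp hH with rfl | ⟨i, j, hij, rfl⟩ | ⟨i, j, hij, rfl⟩ | ⟨i, c, hc, rfl⟩
  · exact Or.inl rfl
  · have hi : i ≠ v := by
      rintro rfl
      simp [hij.symm] at hv
    have hj : j ≠ v := by
      rintro rfl
      simp [hij] at hv
    refine Or.inr (Or.inl ⟨⟨i, hi⟩, ⟨j, hj⟩, by simpa using hij, ?_⟩)
    ext y
    simp [homog, glue, hi, hj]
  · have hne : i ≠ j := hE _ hij
    have hi : i ≠ v := by
      rintro rfl
      simp [hne.symm] at hv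
    have hj : j ≠ v := by
      rintro rfl
      simp [hne] at hv
    refine Or.inr (Or.inr (Or.inl ⟨⟨i, hi⟩, ⟨j, hj⟩, mem_Eres.mpr hij, ?_⟩))
    ext y
    simp [homog, glue, hi, hj]
  · have hi : i ≠ v := by
      rintro rfl
      simp at hv
    refine Or.inr (Or.inr (Or.inr ⟨⟨i, hi⟩, c, hc, ?_⟩))
    ext y
    simp [homog, glue, hi]

/-- If `v` is simplicial with nonempty weight, then `X_v` is the `v`-axis. -/
lemma Simplicial.eq_zero_of_mem_Xv (hv : Simplicial E a b v)
    {c : ℤ} (hc : c ∈ Finset.Icc (a v) (b v)) {x : Option ι → ℝ} (hx : x ∈ Xv E a b v)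
    {j : ι} (hj : j ≠ v) : x (some j) = 0 := by
  have hcone : inter (coneDigArr E a b) = {0} := by
    ext x
    rw [mem_inter, Set.mem_singleton_iff]
    constructor
    · intro h
      have h0 : x none = 0 := h _ (mem_coneDigArr.mpr (Or.inl rfl))
      have h1 : x (some v) = 0 := by
        have : x (some v) = c * x none :=
          h _ (mem_coneDigArr.mpr (Or.inr (Or.inr (Or.inr ⟨v, c, hc, rfl⟩))))
        rw [this, h0, mul_zero]
      ext (_ | i)
      · exact h0
      · by_cases hi : i = v
        · rw [hi]
          exact h1
        · have : x (some i) - x (some v) = 0 :=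
            h _ (mem_coneDigArr.mpr (Or.inr (Or.inl ⟨i, v, hi, rfl⟩)))
          rw [h1, sub_zero] at this
          exact this
    · rintro rfl H hH
      rcases mem_coneDigArr.mp hH with rfl | ⟨i, j, hij, rfl⟩ | ⟨i, j, hij, rfl⟩ | ⟨i, c, hc, rfl⟩
        <;> simp
  have hmem : ({0} : Set (Option ι → ℝ)) ∈ L (coneDigArr E a b) :=
    mem_L_iff.mpr ⟨⟨_, subset_rfl, hcone⟩, Set.singleton_nonempty 0⟩
  have hdim0 : dim ({0} : Set (Option ι → ℝ)) = 0 := by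
    rw [dim, direction_affineSpan, vectorSpan_singleton, finrank_bot]
  have hrank : Fintype.card ι + 1 ≤ rank (coneDigArr E a b) := by
    have := Finset.le_sup (f := fun X : Set (Option ι → ℝ) => Fintype.card (Option ι) - dim X) hmem
    simpa only [hdim0, Fintype.card_option, tsub_zero, rank] using this
  have hcard := hv.2
  have hpos : 0 < Fintype.card ι := Fintype.card_pos_iff.mpr ⟨v⟩
  rw [Fintype.card_option] at hcard
  have hdim : dim (Xv E a b v) ≤ 1 := by omega
  rw [dim, direction_affineSpan, finrank_le_one_iff] at hdim
  obtain ⟨u, hu⟩ := hdim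
  have hspan : ∀ y ∈ Xv E a b v, ∃ t : ℝ, t • (u : Option ι → ℝ) = y := by
    intro y hy
    obtain ⟨t, ht⟩ := hu ⟨y, by simpa using vsub_mem_vectorSpan ℝ hy zero_mem_Xv⟩
    exact ⟨t, congrArg Subtype.val ht⟩
  obtain ⟨s, hs⟩ := hspan _ single_mem_Xv
  obtain ⟨t, rfl⟩ := hspan x hx
  have h1 := congrFun hs (some v)
  have h2 := congrFun hs (some j)
  simp [hj] at h1 h2
  rcases h2 with rfl | h2
  · simp at h1
  · simp [h2]

lemma Simplicial.linForm_eq_of_mem_Xv (hv : Simplicial E a b v)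
    {k l : Option {i : ι // i ≠ v} × ℤ} (hk : k ∈ pencil v E a b) (hl : l ∈ pencil v E a b)
    {x : Option ι → ℝ} (hx : x ∈ Xv E a b v) : linForm v k x = linForm v l x := by
  have hz : x none = 0 := hx.1
  have hnone : ∀ c : ℤ, (none, c) ∈ pencil v E a b → c ∈ Finset.Icc (a v) (b v) := by
    intro c h
    simpa [mem_pencil] using h
  obtain ⟨_ | i, c⟩ := k <;> obtain ⟨_ | j, d⟩ := l
  · simp [hz]
  · simp [hz, hv.eq_zero_of_mem_Xv (hnone c hk) hx j.2]
  · simp [hz, hv.eq_zero_of_mem_Xv (hnone d hl) hx i.2]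
  · simpa [hz] using sub_eq_zero.mp (hx.2.1 i j i.2 j.2)

open Pointwise in
lemma Simplicial.isFiberType (hE : ∀ e ∈ E, e.1 ≠ e.2) (hv : Simplicial E a b v) :
    IsFiberType (digArr (Eres E v) (fun i => a i.1) (fun i => b i.1))
      (pencil v E a b) (affForm v) := by
  intro k hk l hl hkl
  refine ⟨affForm_injective.ne hkl, ?_⟩
  rintro ⟨y₀, hy₀⟩
  set φ := linForm v k - linForm v l with hφ
  have hφhomog : ∀ y, φ (homog v y) = 0 ↔ affForm v k y = affForm v l y := by
    intro y
    rw [hφ, LinearMap.sub_apply, linForm_homog, linForm_homog, sub_eq_zero]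
  obtain ⟨w, hw⟩ : ∃ w, φ w ≠ 0 := by
    by_contra! h
    exact hkl (affForm_injective (AffineMap.ext fun y => (hφhomog y).mp (h _)))
  set Y : Set (Option ι → ℝ) :=
    {x | x (some v) = linForm v k x} ∩ {x | x (some v) = linForm v l x} with hY
  have hYL : Y ∈ L (coneDigArr E a b) := by
    refine mem_L_iff.mpr ⟨⟨{{x | x (some v) = linForm v k x}, {x | x (some v) = linForm v l x}},
      ?_, ?_⟩, ⟨0, by simp [hY]⟩⟩
    · simp [Finset.insert_subset_iff, linForm_hyperplane_mem_coneDigArr hk,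
        linForm_hyperplane_mem_coneDigArr hl]
    · ext x
      simp [mem_inter, hY]
  obtain ⟨⟨B, hB, hBY⟩, -⟩ := mem_L_iff.mp (hv.1.2 Y hYL)
  obtain ⟨H, hH⟩ : B.Nonempty := by
    by_contra hne
    rw [Finset.not_nonempty_iff_eq_empty] at hne
    have hmem : w ∈ Xv E a b v + Y := by
      rw [← hBY, mem_inter]
      simp [hne]
    obtain ⟨p, hp, q, hq, rfl⟩ := Set.mem_add.mp hmem
    apply hw
    rw [map_add, hφ, LinearMap.sub_apply, LinearMap.sub_apply, hv.linForm_eq_of_mem_Xv hk hl hp,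
      ← hq.1, ← hq.2]
    simp
  have hsub : ∀ p ∈ Xv E a b v, ∀ q ∈ Y, p + q ∈ H := by
    intro p hp q hq
    have : p + q ∈ inter B := hBY ▸ Set.add_mem_add hp hq
    exact mem_inter.mp this H hH
  have hsingle : (Pi.single (some v) 1 : Option ι → ℝ) ∈ H := by
    simpa using hsub _ single_mem_Xv 0 (by simp [hY])
  obtain ⟨W, rfl, hW⟩ := exists_submodule_of_mem_coneDigArr hE (hB hH)
  have hindep : ∀ (m : Option {i : ι // i ≠ v} × ℤ) (x : Option ι → ℝ) (t : ℝ),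
      linForm v m (x + t • Pi.single (some v) 1) = linForm v m x := by
    rintro ⟨_ | j, c⟩ x t
    · simp
    · simp [j.2]
  have hker : ∀ x, φ x = 0 → x ∈ W := by
    intro x hx
    have hx' : linForm v k x = linForm v l x := sub_eq_zero.mp hx
    set t := linForm v k x - x (some v) with ht
    have hmem : x + t • Pi.single (some v) 1 ∈ W := by
      have := hsub 0 zero_mem_Xv (x + t • Pi.single (some v) 1)
        ⟨by simp [hindep, ht], by simp [hindep, ht, hx']⟩
      simpa using this
    exact (add_mem_cancel_right (W.smul_mem t hsingle)).mp hmem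
  have hWφ : ∀ x, x ∈ W ↔ φ x = 0 := by
    refine fun x => ⟨fun hx => ?_, hker x⟩
    by_contra hne
    refine hW (Submodule.eq_top_iff'.mpr fun y => ?_)
    have : y - (φ y / φ x) • x ∈ W := hker _ (by simp [hne])
    simpa using W.add_mem this (W.smul_mem (φ y / φ x) hx)
  rcases eq_infinite_or_of_single_mem hE (hB hH) hsingle with h | h
  · have : homog v y₀ ∈ (W : Set _) := (hWφ _).mpr ((hφhomog _).mpr hy₀)
    rw [h] at this
    simp at this
  · convert h using 1
    ext y
    simp [hWφ, hφhomog]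

end Digraphical

end Paper

open Paper in
/-- if `v` is a simplicial vertex of `(G,ψ)`, then
`χ_{A(G,ψ)}(t) = (t - (|ψ(v)| + e + ℓ - 1))·χ_{A(G∖v, ψ|)}(t)`, where `e` is the number
of edges incident to or from `v`. -/
theorem simplicial_charPoly (ℓ : ℕ) (E : Finset (Fin ℓ × Fin ℓ)) (hE : ∀ e ∈ E, e.1 ≠ e.2)
    (a b : Fin ℓ → ℤ) (v : Fin ℓ) (hv : Simplicial E a b v) :
    charPoly (digArr E a b)
      = (Polynomial.X - Polynomial.C
            (((Finset.Icc (a v) (b v)).card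
              + (E.filter fun e => e.1 = v ∨ e.2 = v).card + ℓ - 1 : ℕ) : ℤ))
        * charPoly (digArr (Eres E v) (fun i => a i.1) (fun i => b i.1)) := by
  rw [digArr_eq_graphArr hE, charPoly_graphArr (hv.isFiberType hE), card_pencil hE,
    Fintype.card_fin]
  congr!
end
end

section
/- For all integers 1 ≤ k ≤ ℓ, the characteristic polynomial of the ψ_ℓ^k-digraphical arrangement A(T_ℓ^k, ψ_ℓ^k) equals (t − (ℓ+1))^ℓ; in particular it does not depend on k. -/
open scoped Classical
open Finset

noncomputable section

namespace Paper

variable {ι : Type}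

lemma inter_image {τ : Type*} (S : Finset τ) (H : τ → Set (ι → ℝ)) :
    inter (S.image H) = ⋂ t ∈ S, H t := by
  simp [inter]

lemma mem_L_image {τ : Type*} {T : Finset τ} {H : τ → Set (ι → ℝ)} {X : Set (ι → ℝ)} :
    X ∈ L (T.image H) ↔ X.Nonempty ∧ ∃ S ⊆ T, ⋂ t ∈ S, H t = X := by
  constructor
  · intro h
    obtain ⟨h, hX⟩ := Finset.mem_filter.mp h
    obtain ⟨B, hB, rfl⟩ := Finset.mem_image.mp h
    obtain ⟨S, hS, rfl⟩ := Finset.subset_image_iff.mp (Finset.mem_powerset.mp hB)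
    exact ⟨hX, S, hS, (inter_image S H).symm⟩
  · rintro ⟨hX, S, hS, rfl⟩
    exact Finset.mem_filter.mpr ⟨Finset.mem_image.mpr
      ⟨S.image H, Finset.mem_powerset.mpr (Finset.image_subset_image hS), inter_image S H⟩, hX⟩

/-- Whitney's formula for the Möbius function of an indexed family of proper subsets. -/
lemma mob_image {τ : Type*} (T : Finset τ) (H : τ → Set (ι → ℝ))
    (hH : ∀ t ∈ T, H t ≠ Set.univ) (X : Set (ι → ℝ)) (hX : X ∈ L (T.image H)) :
    mob (T.image H) X = ∑ S ∈ T.powerset with ⋂ t ∈ S, H t = X, (-1) ^ #S := by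
  induction hn : #(above (T.image H) X) using Nat.strong_induction_on generalizing X with
  | _ n ih =>
    have hne := (mem_L_image.mp hX).1
    by_cases hu : X = Set.univ
    · subst hu
      rw [mob, if_pos rfl]
      have : (T.powerset.filter fun S => ⋂ t ∈ S, H t = Set.univ) = {∅} := by
        ext S
        simp only [mem_filter, mem_powerset, mem_singleton, Set.iInter_eq_univ]
        constructor
        · rintro ⟨hS, h⟩
          exact Finset.eq_empty_of_forall_notMem fun t ht => hH t (hS ht) (h t ht)
        · rintro rfl
          simp
      rw [this]
      simp
    · rw [mob, if_neg hu, Finset.sum_attach (above (T.image H) X) (mob (T.image H))]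
      have hsum : ∑ Y ∈ above (T.image H) X, mob (T.image H) Y =
          ∑ S ∈ T.powerset with X ⊂ ⋂ t ∈ S, H t, (-1 : ℤ) ^ #S := by
        rw [← Finset.sum_fiberwise_of_maps_to (s := T.powerset.filter fun S => X ⊂ ⋂ t ∈ S, H t)
          (t := above (T.image H) X) (g := fun S => ⋂ t ∈ S, H t)]
        · refine Finset.sum_congr rfl fun Y hY => ?_
          rw [ih _ (hn ▸ above_lt hY) Y (Finset.mem_filter.mp hY).1 rfl, Finset.filter_filter]
          refine Finset.sum_congr (Finset.filter_congr fun S _ => ?_) fun _ _ => rfl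
          constructor
          · intro h
            exact ⟨h ▸ (Finset.mem_filter.mp hY).2, h⟩
          · exact fun h => h.2
        · intro S hS
          obtain ⟨hS, hXS⟩ := Finset.mem_filter.mp hS
          exact Finset.mem_filter.mpr ⟨mem_L_image.mpr
            ⟨hne.mono hXS.subset, S, Finset.mem_powerset.mp hS, rfl⟩, hXS⟩
      have htot : ∑ S ∈ T.powerset with X ⊆ ⋂ t ∈ S, H t, (-1 : ℤ) ^ #S = 0 := by
        have : (T.powerset.filter fun S => X ⊆ ⋂ t ∈ S, H t) =
            (T.filter fun t => X ⊆ H t).powerset := by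
          ext S
          simp only [mem_filter, mem_powerset, Set.subset_iInter_iff, Finset.subset_iff]
          grind
        rw [this, Finset.sum_powerset_neg_one_pow_card_of_nonempty]
        by_contra hempty
        obtain ⟨-, S, hS, rfl⟩ := mem_L_image.mp hX
        refine hu ?_
        have : S = ∅ := by
          refine Finset.eq_empty_of_forall_notMem fun t ht => hempty ⟨t, ?_⟩
          exact Finset.mem_filter.mpr ⟨hS ht, Set.biInter_subset_of_mem (t := H) ht⟩
        simp [this]
      rw [hsum, neg_eq_iff_add_eq_zero, ← htot, ← Finset.sum_union]
      · refine Finset.sum_congr ?_ fun _ _ => rfl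
        ext S
        simp only [mem_union, mem_filter, subset_iff_ssubset_or_eq, eq_comm (a := X)]
        tauto
      · rw [Finset.disjoint_filter]
        rintro S - h rfl
        exact h.ne rfl

lemma charPoly_image {τ : Type*} (T : Finset τ) (H : τ → Set (ι → ℝ))
    (hH : ∀ t ∈ T, H t ≠ Set.univ) :
    charPoly (T.image H) = ∑ S ∈ T.powerset with (⋂ t ∈ S, H t).Nonempty,
      Polynomial.C ((-1) ^ #S) * Polynomial.X ^ dim (⋂ t ∈ S, H t) := by
  rw [charPoly, ← Finset.sum_fiberwise_of_maps_to
    (s := T.powerset.filter fun S => (⋂ t ∈ S, H t).Nonempty) (t := L (T.image H))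
    (g := fun S => ⋂ t ∈ S, H t)]
  · refine Finset.sum_congr rfl fun X hX => ?_
    rw [mob_image T H hH X hX, map_sum, Finset.sum_mul, Finset.filter_filter]
    have hne := (mem_L_image.mp hX).1
    refine Finset.sum_congr (Finset.filter_congr fun S _ => ?_) fun S hS => ?_
    · constructor
      · exact fun h => ⟨h ▸ hne, h⟩
      · exact fun h => h.2
    · rw [(Finset.mem_filter.mp hS).2.2]
  · intro S hS
    obtain ⟨hS, hne⟩ := Finset.mem_filter.mp hS
    exact mem_L_image.mpr ⟨hne, S, Finset.mem_powerset.mp hS, rfl⟩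

/-- The extension of a vector by the value `0` at an additional coordinate. -/
def extendZero {R : Type} [Zero R] (x : ι → R) (a : Option ι) : R := a.elim 0 x

/-- The triple `(a, b, n)` stands for the equation `x a - x b = n`, where the coordinate of
`none` is `0`. -/
def Sat {R : Type} [CommRing R] (g : Option ι × Option ι × ℤ) (x : ι → R) : Prop :=
  extendZero x g.1 - extendZero x g.2.1 = (g.2.2 : R)

/-- The vectors solving the triangular system `x a = x (r a) + c a`. -/
def Solved {R : Type} [CommRing R] (r : Option ι → Option ι) (c : Option ι → ℤ)
    (x : ι → R) : Prop :=
  ∀ a, extendZero x a = extendZero x (r a) + (c a : R)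

/-- `r` retracts onto a set of free coordinates, on which the shifts `c` vanish. -/
structure IsRetract (r : Option ι → Option ι) (c : Option ι → ℤ) : Prop where
  none_eq : r none = none
  idem : ∀ a, r (r a) = r a
  shift_eq : ∀ a, c (r a) = 0

lemma IsRetract.eliminate {r : Option ι → Option ι} {c : Option ι → ℤ} (h : IsRetract r c)
    {a b : Option ι} (ha : r a = a) (hb : r b = b) (hab : a ≠ b) (ha0 : a ≠ none) (n : ℤ) :
    ∃ r' c', IsRetract (ι := ι) r' c' ∧ ∀ (R : Type) [CommRing R] (x : ι → R),
      (Solved r c x ∧ extendZero x a = extendZero x b + (n : R)) ↔ Solved r' c' x := by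
  have hca : c a = 0 := ha ▸ h.shift_eq a
  have hcb : c b = 0 := hb ▸ h.shift_eq b
  refine ⟨fun z => if r z = a then b else r z, fun z => if r z = a then c z + n else c z,
    ⟨?_, ?_, ?_⟩, ?_⟩
  · simp [h.none_eq, ha0.symm]
  · intro z
    have := h.idem z
    split_ifs <;> simp_all
  · intro z
    have := h.idem z
    have := h.shift_eq z
    split_ifs <;> simp_all
  · intro R _ x
    constructor
    · rintro ⟨hx, hn⟩ z
      have := hx z
      dsimp only
      split_ifs with hz
      · rw [this, hz, hn]
        push_cast
        ring
      · exact this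
    · intro hx
      have hn : extendZero x a = extendZero x b + (n : R) := by
        simpa [ha, hca] using hx a
      refine ⟨fun z => ?_, hn⟩
      have := hx z
      dsimp only at this
      split_ifs at this with hz
      · rw [this, hz, hn]
        push_cast
        ring
      · exact this

lemma exists_retract (S : Finset (Option ι × Option ι × ℤ)) :
    (∃ d : ℤ, d ≠ 0 ∧ ∀ (R : Type) [CommRing R] (x : ι → R),
      (∀ g ∈ S, Sat g x) → (d : R) = 0) ∨
    ∃ r c, IsRetract (ι := ι) r c ∧ ∀ (R : Type) [CommRing R] (x : ι → R),
      (∀ g ∈ S, Sat g x) ↔ Solved r c x := by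
  induction S using Finset.induction_on with
  | empty =>
    refine Or.inr ⟨id, fun _ => 0, ⟨rfl, fun _ => rfl, fun _ => rfl⟩, fun R _ x => ?_⟩
    simp [Solved]
  | insert g S _ ih =>
    obtain ⟨a, b, n⟩ := g
    rcases ih with ⟨d, hd, h⟩ | ⟨r, c, hrc, h⟩
    · exact Or.inl ⟨d, hd, fun R _ x hx =>
        h R x fun g hg => hx g (Finset.mem_insert_of_mem hg)⟩
    have key : ∀ (R : Type) [CommRing R] (x : ι → R),
        (∀ g ∈ insert (a, b, n) S, Sat g x) ↔ Solved r c x ∧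
          extendZero x (r a) = extendZero x (r b) + ((n - c a + c b : ℤ) : R) := by
      intro R _ x
      rw [Finset.forall_mem_insert, h, and_comm]
      refine and_congr_right fun hx => ?_
      rw [Sat, hx a, hx b]
      push_cast
      constructor <;> intro h <;> linear_combination h
    by_cases hab : r a = r b
    · by_cases hn : n - c a + c b = 0
      · refine Or.inr ⟨r, c, hrc, fun R _ x => ?_⟩
        rw [key, hab, hn]
        simp
      · refine Or.inl ⟨_, hn, fun R _ x hx => ?_⟩
        have := ((key R x).mp hx).2
        rw [hab] at this
        exact left_eq_add.mp this
    · by_cases ha0 : r a = none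
      · obtain ⟨r', c', h', hs⟩ := hrc.eliminate (hrc.idem b) (hrc.idem a) (Ne.symm hab)
          (fun hb0 => hab (ha0.trans hb0.symm)) (-(n - c a + c b))
        refine Or.inr ⟨r', c', h', fun R _ x => ?_⟩
        rw [key, ← hs]
        refine and_congr_right fun _ => ?_
        push_cast
        constructor <;> intro h <;> linear_combination -h
      · obtain ⟨r', c', h', hs⟩ := hrc.eliminate (hrc.idem a) (hrc.idem b) hab ha0 (n - c a + c b)
        exact Or.inr ⟨r', c', h', fun R _ x => by rw [key, ← hs]⟩

/-- Solutions of a triangular system are uniquely determined by arbitrary values on the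
free coordinates. -/
lemma IsRetract.bijOn {r : Option ι → Option ι} {c : Option ι → ℤ} (h : IsRetract r c)
    (R : Type) [CommRing R] :
    Set.BijOn (fun (x : ι → R) (i : {i // r (some i) = some i}) => x i)
      {x | Solved r c x} Set.univ := by
  refine ⟨fun _ _ => Set.mem_univ _, ?_, ?_⟩
  · intro x hx y hy hxy
    have hroot : ∀ a, extendZero x (r a) = extendZero y (r a) := by
      intro a
      have hi := h.idem a
      rcases hra : r a with _ | i
      · rfl
      · rw [hra] at hi
        exact congrFun hxy ⟨i, hi⟩
    funext i
    have hxi := hx (some i)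
    have hyi := hy (some i)
    rw [hroot, ← hyi] at hxi
    exact hxi
  · intro y _
    let z : ι → R := fun i => if hi : r (some i) = some i then y ⟨i, hi⟩ else 0
    let x : ι → R := fun i => extendZero z (r (some i)) + (c (some i) : R)
    have hx : ∀ a, extendZero x a = extendZero z (r a) + (c a : R) := by
      rintro (_ | i)
      · have := h.shift_eq none
        rw [h.none_eq] at this
        simp [extendZero, h.none_eq, this]
      · rfl
    refine ⟨x, fun a => ?_, ?_⟩
    · rw [hx, hx (r a), h.idem, h.shift_eq]
      simp
    · funext ⟨i, hi⟩
      have hc := h.shift_eq (some i)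
      rw [hi] at hc
      simp [x, z, extendZero, hi, hc]

lemma IsRetract.card [Fintype ι] {r : Option ι → Option ι} {c : Option ι → ℤ}
    (h : IsRetract r c) (R : Type) [CommRing R] [Finite R] :
    Nat.card {x : ι → R // Solved r c x} =
      Nat.card R ^ Fintype.card {i // r (some i) = some i} := by
  rw [← Nat.card_eq_fintype_card, ← Nat.card_fun]
  exact Nat.card_congr ((h.bijOn R).equiv.trans (Equiv.Set.univ _))

lemma IsRetract.dim_eq [Fintype ι] {r : Option ι → Option ι} {c : Option ι → ℤ}
    (h : IsRetract r c) :
    dim {x : ι → ℝ | Solved r c x} = Fintype.card {i // r (some i) = some i} := by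
  have ext_add : ∀ (x y : ι → ℝ) a, extendZero (x + y) a = extendZero x a + extendZero y a := by
    rintro x y (_ | i) <;> simp [extendZero]
  have ext_smul : ∀ (t : ℝ) (x : ι → ℝ) a, extendZero (t • x) a = t * extendZero x a := by
    rintro t x (_ | i) <;> simp [extendZero]
  have h0 : IsRetract r (fun _ => 0) := ⟨h.none_eq, h.idem, fun _ => rfl⟩
  let D : Submodule ℝ (ι → ℝ) :=
    { carrier := {x | Solved r (fun _ => 0) x}
      zero_mem' := by rintro (_ | i) <;> rcases r _ with _ | j <;> simp [extendZero]
      add_mem' := by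
        intro x y hx hy a
        rw [ext_add, ext_add, hx a, hy a]
        simp
      smul_mem' := by
        intro t x hx a
        rw [ext_smul, ext_smul, hx a]
        simp }
  obtain ⟨p, hp, -⟩ := (h.bijOn ℝ).surjOn (Set.mem_univ 0)
  have hS : {x : ι → ℝ | Solved r c x} = (AffineSubspace.mk' p D : Set (ι → ℝ)) := by
    ext x
    rw [SetLike.mem_coe, AffineSubspace.mem_mk', vsub_eq_sub]
    change _ ↔ Solved _ _ _
    refine forall_congr' fun a => ?_
    have hxa := ext_add (x - p) p a
    have hxr := ext_add (x - p) p (r a)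
    rw [sub_add_cancel] at hxa hxr
    rw [hxa, hxr, hp a]
    push_cast
    constructor <;> intro h <;> linear_combination h
  rw [dim, hS, AffineSubspace.affineSpan_coe, AffineSubspace.direction_mk']
  let f : D →ₗ[ℝ] ({i // r (some i) = some i} → ℝ) :=
    (LinearMap.funLeft ℝ ℝ Subtype.val).comp D.subtype
  have hf : Function.Bijective f := by
    refine ⟨fun x y hxy => Subtype.ext ((h0.bijOn ℝ).injOn x.2 y.2 hxy), fun y => ?_⟩
    obtain ⟨x, hx, rfl⟩ := (h0.bijOn ℝ).surjOn (Set.mem_univ y)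
    exact ⟨⟨x, hx⟩, rfl⟩
  rw [(LinearEquiv.ofBijective f hf).finrank_eq]
  simp

lemma eventually_card_sat [Fintype ι] (S : Finset (Option ι × Option ι × ℤ)) :
    ∀ᶠ q : ℕ in Filter.atTop,
      (Nat.card {x : ι → ZMod q // ∀ g ∈ S, Sat g x} : ℤ) =
        if (⋂ g ∈ S, {x : ι → ℝ | Sat g x}).Nonempty
          then (q : ℤ) ^ dim (⋂ g ∈ S, {x : ι → ℝ | Sat g x}) else 0 := by
  have hset : (⋂ g ∈ S, {x : ι → ℝ | Sat g x}) = {x | ∀ g ∈ S, Sat g x} := by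
    ext
    simp
  rw [hset]
  rcases exists_retract S with ⟨d, hd, h⟩ | ⟨r, c, hrc, h⟩
  · filter_upwards [Filter.eventually_gt_atTop d.natAbs] with q hq
    rw [if_neg, Nat.cast_eq_zero, Nat.card_eq_zero]
    · refine Or.inl ⟨fun x => ?_⟩
      have := (ZMod.intCast_zmod_eq_zero_iff_dvd d q).mp (h _ x.1 x.2)
      have := Nat.le_of_dvd (Int.natAbs_pos.mpr hd) (Int.natCast_dvd.mp this)
      omega
    · rintro ⟨x, hx⟩
      exact hd (Int.cast_eq_zero.mp (h ℝ x hx))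
  · filter_upwards [Filter.eventually_gt_atTop 0] with q hq
    have : NeZero q := ⟨hq.ne'⟩
    simp only [h]
    obtain ⟨p, hp, -⟩ := (hrc.bijOn ℝ).surjOn (Set.mem_univ 0)
    rw [if_pos ⟨p, hp⟩, hrc.dim_eq, hrc.card]
    simp

/-- The finite field method for arrangements of hyperplanes `x a - x b = n`. -/
lemma charPoly_eval [Fintype ι] (T : Finset (Option ι × Option ι × ℤ))
    (hT : ∀ g ∈ T, g.1 ≠ g.2.1) :
    ∀ᶠ q : ℕ in Filter.atTop,
      (charPoly (T.image fun g => {x : ι → ℝ | Sat g x})).eval (q : ℤ) =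
        Nat.card {x : ι → ZMod q // ∀ g ∈ T, ¬ Sat g x} := by
  have hall : ∀ᶠ q : ℕ in Filter.atTop, ∀ S ∈ T.powerset,
      (Nat.card {x : ι → ZMod q // ∀ g ∈ S, Sat g x} : ℤ) =
        if (⋂ g ∈ S, {x : ι → ℝ | Sat g x}).Nonempty
          then (q : ℤ) ^ dim (⋂ g ∈ S, {x : ι → ℝ | Sat g x}) else 0 :=
    (Filter.eventually_all_finset _).mpr fun S _ => eventually_card_sat S
  filter_upwards [hall, Filter.eventually_gt_atTop 0] with q hq hq0
  have : NeZero q := ⟨hq0.ne'⟩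
  rw [charPoly_image, Polynomial.eval_finsetSum, Finset.sum_filter]
  · have hterm : ∀ S ∈ T.powerset, (if (⋂ g ∈ S, {x : ι → ℝ | Sat g x}).Nonempty then
        (Polynomial.C ((-1) ^ #S) * Polynomial.X ^ dim (⋂ g ∈ S, {x : ι → ℝ | Sat g x})).eval
          (q : ℤ) else 0) =
        ∑ x : ι → ZMod q, if ∀ g ∈ S, Sat g x then (-1 : ℤ) ^ #S else 0 := by
      intro S hS
      have := hq S hS
      rw [← Finset.sum_filter, Finset.sum_const, ← Fintype.card_subtype, ← Nat.card_eq_fintype_card,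
        nsmul_eq_mul, this]
      split_ifs <;> simp [mul_comm]
    rw [Finset.sum_congr rfl hterm, Finset.sum_comm, Nat.card_eq_fintype_card,
      Fintype.card_subtype, Finset.card_filter, Nat.cast_sum]
    refine Finset.sum_congr rfl fun x _ => ?_
    have : (T.powerset.filter fun S => ∀ g ∈ S, Sat g x) = (T.filter fun g => Sat g x).powerset := by
      ext S
      simp only [mem_filter, mem_powerset, Finset.subset_iff]
      grind
    rw [← Finset.sum_filter, this, Finset.sum_powerset_neg_one_pow_card]
    simp [Finset.filter_eq_empty_iff]
  · rintro ⟨a, b, n⟩ hg hu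
    have hab := hT _ hg
    rw [Set.eq_univ_iff_forall] at hu
    rcases a with _ | i
    · rcases b with _ | j
      · exact hab rfl
      · have := hu fun _ => 1 - n
        simp [Sat, extendZero] at this
    · have := hu (Pi.single i (n + 1))
      rcases b with _ | j
      · simp [Sat, extendZero] at this
      · have hij : j ≠ i := fun h => hab (by rw [h])
        simp [Sat, extendZero, hij] at this

/-- Placements of `n` labels at distinct positions, label `i` being below `r + max m (i + 1)`,
in which, among the labels below `m`, consecutive positions carry increasing labels. -/
def IsPlacement (r m n : ℕ) (y : Fin n → ℕ) : Prop :=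
  (∀ i, y i < r + max m (i + 1)) ∧ Function.Injective y ∧
    ∀ i j : Fin n, i < j → (j : ℕ) < m → y i ≠ y j + 1

lemma card_sigma_notMem {n : ℕ} {P : (Fin n → ℕ) → Prop} (N : ℕ)
    [Finite {y // P y}] (hinj : ∀ y, P y → Function.Injective y) (hN : ∀ y, P y → ∀ i, y i < N) :
    Nat.card (Σ y : {y // P y}, {v // v < N ∧ v ∉ Set.range y.1}) =
      Nat.card {y // P y} * (N - n) := by
  have hfib : ∀ y : {y // P y}, {v | v < N ∧ v ∉ Set.range y.1} =
      (Finset.range N \ Finset.univ.image y.1 : Finset ℕ) := by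
    intro y
    ext v
    simp
  have hcard : ∀ y : {y // P y}, Nat.card {v // v < N ∧ v ∉ Set.range y.1} = N - n := by
    intro y
    change Nat.card {v | v < N ∧ v ∉ Set.range y.1} = N - n
    rw [hfib, Nat.card_eq_card_toFinset, Finset.toFinset_coe, Finset.card_sdiff_of_subset,
      Finset.card_range, Finset.card_image_of_injective _ (hinj _ y.2), Finset.card_fin]
    intro v hv
    obtain ⟨i, -, rfl⟩ := Finset.mem_image.mp hv
    exact Finset.mem_range.mpr (hN _ y.2 i)
  have : ∀ y : {y // P y}, Finite {v // v < N ∧ v ∉ Set.range y.1} := fun y =>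
    Set.Finite.to_subtype ((Set.finite_lt_nat N).subset fun v hv => hv.1)
  have := Fintype.ofFinite {y // P y}
  rw [Nat.card_sigma, Finset.sum_congr rfl fun y _ => hcard y]
  simp

instance finite_isPlacement (r m n : ℕ) : Finite {y // IsPlacement r m n y} := by
  refine Set.Finite.to_subtype ((Set.Finite.pi' fun i : Fin n =>
    Set.finite_lt_nat (r + max m (i + 1))).subset fun y hy => hy.1)

lemma card_isPlacement_succ {r m n : ℕ} (hmn : m ≤ n) :
    Nat.card {y // IsPlacement r m (n + 1) y} =
      Nat.card {y // IsPlacement r m n y} * (r + 1) := by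
  have h := card_sigma_notMem (P := IsPlacement r m n) (r + (n + 1)) (fun y hy => hy.2.1)
    (fun y hy i => by have := hy.1 i; omega)
  rw [show r + (n + 1) - n = r + 1 by omega] at h
  rw [← h]
  refine Nat.card_congr ⟨fun y => ⟨⟨fun i => y.1 i.castSucc, ?_, ?_, ?_⟩,
    ⟨y.1 (Fin.last n), ?_, ?_⟩⟩, fun z => ⟨Fin.snoc z.1.1 z.2.1, ?_, ?_, ?_⟩, ?_, ?_⟩
  · exact fun i => y.2.1 i.castSucc
  · exact y.2.2.1.comp (Fin.castSucc_injective n)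
  · exact fun i j hij hj => y.2.2.2 i.castSucc j.castSucc hij hj
  · have := y.2.1 (Fin.last n)
    simpa [hmn.trans n.le_succ] using this
  · rintro ⟨i, hi⟩
    exact (Fin.castSucc_lt_last i).ne (y.2.2.1 hi)
  · intro i
    induction i using Fin.lastCases with
    | last => simpa [hmn.trans n.le_succ] using z.2.2.1
    | cast i => simpa using z.1.2.1 i
  · exact Fin.snoc_injective_iff.mpr ⟨z.1.2.2.1, z.2.2.2⟩
  · intro i j hij hj
    have hjn : (j : ℕ) < n := hj.trans_le hmn
    obtain ⟨j, rfl⟩ := Fin.exists_castSucc_eq.mpr (show j ≠ Fin.last n by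
      rintro rfl; simp at hjn)
    obtain ⟨i, rfl⟩ := Fin.exists_castSucc_eq.mpr (show i ≠ Fin.last n by
      rintro rfl; exact absurd hij (Fin.le_last _).not_gt)
    simpa using z.1.2.2.2 i j hij hj
  · intro y
    refine Subtype.ext ?_
    exact Fin.snoc_init_self y.1
  · intro z
    exact Sigma.subtype_ext (Subtype.ext (by simp)) (by simp)

/-- Removing the largest label together with its position. -/
lemma card_isPlacement_insert (r m : ℕ) :
    Nat.card {y // IsPlacement r (m + 1) (m + 1) y} =
      Nat.card {y // IsPlacement r m m y} * (r + 1) := by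
  have h := card_sigma_notMem (P := IsPlacement r m m) (r + (m + 1)) (fun y hy => hy.2.1)
    (fun y hy i => by have := hy.1 i; omega)
  rw [show r + (m + 1) - m = r + 1 by omega] at h
  rw [← h]
  have hne : ∀ (y : {y // IsPlacement r (m + 1) (m + 1) y}) (i : Fin m),
      y.1 i.castSucc ≠ y.1 (Fin.last m) ∧ y.1 i.castSucc ≠ y.1 (Fin.last m) + 1 := fun y i =>
    ⟨fun h => (Fin.castSucc_lt_last i).ne (y.2.2.1 h),
      y.2.2.2 i.castSucc (Fin.last m) (Fin.castSucc_lt_last i) (by simp)⟩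
  have hlt : ∀ (y : {y // IsPlacement r (m + 1) (m + 1) y}) (i : Fin (m + 1)),
      y.1 i < r + (m + 1) := fun y i => by have := y.2.1 i; omega
  refine Nat.card_congr ⟨fun y => ⟨⟨fun i => if y.1 i.castSucc < y.1 (Fin.last m)
      then y.1 i.castSucc else y.1 i.castSucc - 1, ?_, ?_, ?_⟩, ⟨y.1 (Fin.last m), hlt y _, ?_⟩⟩,
    fun z => ⟨Fin.snoc (fun i => if z.1.1 i < z.2.1 then z.1.1 i else z.1.1 i + 1) z.2.1,
      ?_, ?_, ?_⟩, ?_, ?_⟩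
  · intro i
    have := hne y i
    have := hlt y i.castSucc
    have := hlt y (Fin.last m)
    dsimp only
    split_ifs <;> omega
  · intro i j hij
    have := hne y i
    have := hne y j
    refine Fin.castSucc_injective m (y.2.2.1 ?_)
    dsimp only at hij
    split_ifs at hij <;> omega
  · intro i j hij hj
    have := hne y i
    have := hne y j
    have := y.2.2.2 i.castSucc j.castSucc hij (by simp)
    dsimp only
    split_ifs <;> omega
  · rintro ⟨i, hi⟩
    have := hne y i
    dsimp only at hi
    split_ifs at hi <;> omega
  · intro i
    induction i using Fin.lastCases with
    | last => simpa using z.2.2.1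
    | cast i =>
      have := z.1.2.1 i
      simp only [Fin.snoc_castSucc, Fin.val_castSucc]
      split_ifs <;> omega
  · refine Fin.snoc_injective_iff.mpr ⟨fun i j hij => z.1.2.2.1 ?_, ?_⟩
    · dsimp only at hij
      split_ifs at hij <;> omega
    · rintro ⟨i, hi⟩
      dsimp only at hi
      split_ifs at hi <;> omega
  · have hz : ∀ i, z.1.1 i ≠ z.2.1 := fun i hi => z.2.2.2 ⟨i, hi⟩
    intro i j hij hj
    obtain ⟨i, rfl⟩ := Fin.exists_castSucc_eq.mpr (show i ≠ Fin.last m by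
      rintro rfl; exact absurd hij (Fin.le_last _).not_gt)
    have := hz i
    induction j using Fin.lastCases with
    | last =>
      simp only [Fin.snoc_castSucc, Fin.snoc_last]
      split_ifs <;> omega
    | cast j =>
      have := hz j
      have := z.1.2.2.2 i j hij j.2
      simp only [Fin.snoc_castSucc]
      split_ifs <;> omega
  · intro y
    refine Subtype.ext (funext fun i => ?_)
    induction i using Fin.lastCases with
    | last => simp
    | cast i =>
      have := hne y i
      simp only [Fin.snoc_castSucc]
      split_ifs <;> omega
  · rintro ⟨⟨y, hy⟩, ⟨v, hv⟩⟩
    have hz : ∀ i, y i ≠ v := fun i hi => hv.2 ⟨i, hi⟩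
    have : (fun i => if (if y i < v then y i else y i + 1) < v
        then (if y i < v then y i else y i + 1)
        else (if y i < v then y i else y i + 1) - 1) = y := by
      funext i
      have := hz i
      split_ifs <;> omega
    exact Sigma.subtype_ext (Subtype.ext (by simpa using this)) (by simp)

lemma card_isPlacement {r m n : ℕ} (hmn : m ≤ n) :
    Nat.card {y // IsPlacement r m n y} = (r + 1) ^ n := by
  induction n, hmn using Nat.le_induction with
  | base =>
    induction m with
    | zero =>
      have : Unique {y // IsPlacement r 0 0 y} :=
        { default := ⟨Fin.elim0, fun i => i.elim0, fun i => i.elim0, fun i => i.elim0⟩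
          uniq := fun y => Subtype.ext (Subsingleton.elim _ _) }
      simp
    | succ m ih => rw [card_isPlacement_insert, ih, pow_succ]
  | succ n hmn ih => rw [card_isPlacement_succ hmn, ih, pow_succ]

/-- The equations of the hyperplanes of `digArr E a b`. -/
def digEqs {ι : Type} [Fintype ι] (E : Finset (ι × ι)) (a b : ι → ℤ) :
    Finset (Option ι × Option ι × ℤ) :=
  ((univ.filter fun p : ι × ι => p.1 ≠ p.2).image fun p => (some p.1, some p.2, 0))
  ∪ (E.image fun p => (some p.1, some p.2, 1))
  ∪ (univ.biUnion fun i : ι => (Finset.Icc (a i) (b i)).image fun c => (some i, none, c))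

lemma digArr_eq_image {ι : Type} [Fintype ι] (E : Finset (ι × ι)) (a b : ι → ℤ) :
    digArr E a b = (digEqs E a b).image fun g => {x : ι → ℝ | Sat g x} := by
  simp only [digArr, digEqs, Finset.image_union, Finset.image_image, Finset.biUnion_image,
    Function.comp_def, Sat, extendZero, Option.elim, Int.cast_zero, Int.cast_one, sub_zero]
  congr 1
  refine Finset.biUnion_congr rfl fun i _ => ?_
  ext K
  simp [Finset.bind_def]

lemma forall_digEqs {ι : Type} [Fintype ι] {E : Finset (ι × ι)} {a b : ι → ℤ}
    {P : Option ι × Option ι × ℤ → Prop} :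
    (∀ g ∈ digEqs E a b, P g) ↔ (∀ i j, i ≠ j → P (some i, some j, 0)) ∧
      (∀ i j, (i, j) ∈ E → P (some i, some j, 1)) ∧
      ∀ i c, a i ≤ c → c ≤ b i → P (some i, none, c) := by
  simp only [digEqs, Finset.mem_union, Finset.mem_image, Finset.mem_biUnion, Finset.mem_filter,
    Finset.mem_univ, Finset.mem_Icc, true_and]
  constructor
  · intro h
    exact ⟨fun i j hij => h _ (Or.inl (Or.inl ⟨(i, j), hij, rfl⟩)),
      fun i j hij => h _ (Or.inl (Or.inr ⟨(i, j), hij, rfl⟩)),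
      fun i c h1 h2 => h _ (Or.inr ⟨i, c, ⟨h1, h2⟩, rfl⟩)⟩
  · rintro ⟨h1, h2, h3⟩ g ((⟨p, hp, rfl⟩ | ⟨p, hp, rfl⟩) | ⟨i, c, hc, rfl⟩)
    · exact h1 _ _ hp
    · exact h2 _ _ hp
    · exact h3 _ _ hc.1 hc.2

lemma card_complement {ℓ k : ℕ} (hk : 1 ≤ k) (hkl : k ≤ ℓ) (r : ℕ) :
    Nat.card {x : Fin ℓ → ZMod (r + 2 + ℓ) //
      ∀ g ∈ digEqs (Tlk ℓ k) (psiLk ℓ k) (fun _ => 0), ¬ Sat g x} = (r + 1) ^ ℓ := by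
  rw [← card_isPlacement (r := r) (m := ℓ - k + 1) (n := ℓ) (by omega)]
  have hq : NeZero (r + 2 + ℓ) := ⟨by omega⟩
  have key : ∀ (x : Fin ℓ → ZMod (r + 2 + ℓ)) (y : Fin ℓ → ℕ), (∀ i, y i + 1 < r + 2 + ℓ) →
      (∀ i, x i = ((y i + 1 : ℕ) : ZMod (r + 2 + ℓ))) →
      ((∀ g ∈ digEqs (Tlk ℓ k) (psiLk ℓ k) (fun _ => 0), ¬ Sat g x) ↔
        IsPlacement r (ℓ - k + 1) ℓ y) := by
    intro x y hy hx
    have hdvd : ∀ (i j : Fin ℓ) (c : ℤ), x i - x j = (c : ZMod (r + 2 + ℓ)) ↔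
        ((r + 2 + ℓ : ℕ) : ℤ) ∣ y i - y j - c := by
      intro i j c
      rw [← ZMod.intCast_zmod_eq_zero_iff_dvd, hx, hx]
      push_cast
      constructor <;> intro h <;> linear_combination h
    have hdvd' : ∀ (i : Fin ℓ) (c : ℤ), x i = (c : ZMod (r + 2 + ℓ)) ↔
        ((r + 2 + ℓ : ℕ) : ℤ) ∣ y i + 1 - c := by
      intro i c
      rw [← ZMod.intCast_zmod_eq_zero_iff_dvd, hx]
      push_cast
      constructor <;> intro h <;> linear_combination h
    rw [forall_digEqs]
    simp only [Sat, extendZero, Option.elim, sub_zero, hdvd, hdvd', IsPlacement, psiLk, Tlk,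
      Finset.mem_filter, Finset.mem_univ, true_and]
    refine ⟨fun ⟨h1, h2, h3⟩ => ⟨fun i => ?_, fun i j hij => ?_, fun i j hij hj he => ?_⟩,
      fun ⟨h1, h2, h3⟩ => ⟨fun i j hij h => ?_, fun i j hij h => ?_, fun i c hc hc0 h => ?_⟩⟩
    · by_contra hlt
      have := hy i
      refine h3 i (y i + 1 - (r + 2 + ℓ : ℕ)) ?_ ?_ ⟨1, by ring⟩ <;> omega
    · by_contra hne
      exact h1 i j hne (by simp [hij])
    · exact h2 i j ⟨hij, by omega⟩ (by simp [he])
    · have := hy i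
      have := hy j
      have : (y i : ℤ) - y j = 0 := Int.eq_zero_of_abs_lt_dvd h (by rw [abs_lt]; omega)
      exact hij (h2 (by omega))
    · have := h1 i
      have := h1 j
      have : (y i : ℤ) - y j - 1 = 0 := Int.eq_zero_of_abs_lt_dvd h (by rw [abs_lt]; omega)
      exact h3 i j hij.1 (by omega) (by omega)
    · have := h1 i
      have := Int.le_of_dvd (by omega) h
      omega
  refine (Nat.card_eq_of_bijective (fun y => ⟨fun i => ((y.1 i + 1 : ℕ) : ZMod (r + 2 + ℓ)),
    (key _ y.1 (fun i => by have := y.2.1 i; omega) fun _ => rfl).mpr y.2⟩) ⟨?_, ?_⟩).symm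
  · intro y z hyz
    refine Subtype.ext (funext fun i => ?_)
    have h := congrArg ZMod.val (congrFun (congrArg Subtype.val hyz) i)
    have := y.2.1 i
    have := z.2.1 i
    dsimp only at h
    rw [ZMod.val_cast_of_lt (by omega), ZMod.val_cast_of_lt (by omega)] at h
    omega
  · rintro ⟨x, hx⟩
    have h0 : ∀ i, (x i).val ≠ 0 := by
      intro i hi
      refine (forall_digEqs.mp hx).2.2 i 0 ?_ le_rfl ?_
      · simp only [psiLk]
        omega
      · simpa [Sat, extendZero] using hi
    have hval : ∀ i, x i = (((x i).val - 1 + 1 : ℕ) : ZMod (r + 2 + ℓ)) := by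
      intro i
      rw [Nat.sub_add_cancel (Nat.one_le_iff_ne_zero.mpr (h0 i)), ZMod.natCast_zmod_val]
    refine ⟨⟨fun i => (x i).val - 1, (key x _ (fun i => ?_) hval).mp hx⟩,
      Subtype.ext (funext fun i => (hval i).symm)⟩
    have := (x i).val_lt
    have := h0 i
    omega

end Paper

open Paper in
/-- for `1 ≤ k ≤ ℓ`, the characteristic polynomial of
`A(T_ℓ^k, ψ_ℓ^k)` is `(t - (ℓ+1))^ℓ`; in particular it does not depend on `k`. -/
theorem tlk_charPoly (ℓ k : ℕ) (hk : 1 ≤ k) (hkl : k ≤ ℓ) :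
    charPoly (digArr (Tlk ℓ k) (psiLk ℓ k) (fun _ => 0))
      = (Polynomial.X - Polynomial.C ((ℓ : ℤ) + 1)) ^ ℓ := by
  have hne : ∀ g ∈ digEqs (Tlk ℓ k) (psiLk ℓ k) (fun _ => 0), g.1 ≠ g.2.1 := by
    refine forall_digEqs.mpr ⟨fun i j hij => ?_, fun i j hij => ?_, fun i c _ _ => ?_⟩
    · simpa using hij
    · simpa using (Finset.mem_filter.mp hij).2.1.ne
    · simp
  obtain ⟨N, hN⟩ := Filter.eventually_atTop.mp (charPoly_eval _ hne)
  refine Polynomial.eq_of_infinite_eval_eq _ _ (Set.Infinite.mono ?_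
    (Set.infinite_range_of_injective (f := fun r : ℕ => ((N + r + 2 + ℓ : ℕ) : ℤ))
      fun r s h => by simpa using h))
  rintro _ ⟨r, rfl⟩
  have h := hN (N + r + 2 + ℓ) (by omega)
  rw [card_complement hk hkl, ← digArr_eq_image] at h
  rw [Set.mem_ofPred_eq, h]
  simp only [Polynomial.eval_pow, Polynomial.eval_sub, Polynomial.eval_X, Polynomial.eval_C]
  push_cast
  congr 1
  ring
end
end
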